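/- arXiv:2001.06709 — 2 statements merged into one kernel-verified Lean document; each statement's English description precedes it below -/
import Mathlib

section
/- Let A be a k-algebra whose center Z is isomorphic as a k-algebra to a finite direct product Z_1 × ... × Z_m of commutative local k-algebras. Then A is strongly cancellative and strongly Morita cancellative. -/
open scoped TensorProduct

universe u

/-- The polynomial extension `A[t₁,…,tₙ]` of a (possibly noncommutative) `k`-algebra `A`
in `n` central, mutually commuting indeterminates. -/
abbrev PolyExt (A : Type u) [Ring A] (n : ℕ) : Type u :=
  AddMonoidAlgebra A (Fin n →₀ ℕ)

/-- The canonical embedding `A → A[t₁,…,tₙ]` as constant polynomials. -/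
noncomputable def PolyExt.C (k A : Type u) [Field k] [Ring A] [Algebra k A] (n : ℕ) :
    A →ₐ[k] PolyExt A n :=
  AddMonoidAlgebra.singleZeroAlgHom

/-- The `i`-th indeterminate of `A[t₁,…,tₙ]`. -/
noncomputable def PolyExt.X (A : Type u) [Ring A] (n : ℕ) (i : Fin n) : PolyExt A n :=
  AddMonoidAlgebra.single (Finsupp.single i 1) 1

/-- Two rings are Morita equivalent if their categories of right modules are
equivalent (as abelian categories). -/
def MoritaEquivalent (R S : Type u) [Ring R] [Ring S] : Prop :=
  Nonempty (ModuleCat.{u} Rᵐᵒᵖ ≌ ModuleCat.{u} Sᵐᵒᵖ)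

/-- `A` is strongly cancellative: for every `n ≥ 1` and every `k`-algebra `B`, any
`k`-algebra isomorphism `A[s₁,…,sₙ] ≅ B[t₁,…,tₙ]` implies `A ≅ B`. -/
def StronglyCancellative (k A : Type u) [Field k] [Ring A] [Algebra k A] : Prop :=
  ∀ (n : ℕ), 1 ≤ n → ∀ (B : Type u) [Ring B] [Algebra k B],
    Nonempty (PolyExt A n ≃ₐ[k] PolyExt B n) → Nonempty (A ≃ₐ[k] B)

/-- `A` is strongly Morita cancellative: for every `n ≥ 1` and every `k`-algebra `B`,
Morita equivalence of `A[s₁,…,sₙ]` and `B[t₁,…,tₙ]` implies Morita equivalence of `A` and `B`. -/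
def StronglyMoritaCancellative (k A : Type u) [Field k] [Ring A] [Algebra k A] : Prop :=
  ∀ (n : ℕ), 1 ≤ n → ∀ (B : Type u) [Ring B] [Algebra k B],
    MoritaEquivalent (PolyExt A n) (PolyExt B n) → MoritaEquivalent A B

/-- `A` is strongly retractable: every `k`-algebra isomorphism
`φ : A[s₁,…,sₙ] → B[t₁,…,tₙ]` (with `n ≥ 1`) satisfies `φ(A) = B`. -/
def StronglyRetractable (k A : Type u) [Field k] [Ring A] [Algebra k A] : Prop :=
  ∀ (n : ℕ), 1 ≤ n → ∀ (B : Type u) [Ring B] [Algebra k B]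
    (φ : PolyExt A n ≃ₐ[k] PolyExt B n),
    φ '' Set.range (PolyExt.C k A n) = Set.range (PolyExt.C k B n)

/-- `A` is strongly detectable: for every `k`-algebra isomorphism
`φ : A[s₁,…,sₙ] → B[t₁,…,tₙ]` (with `n ≥ 1`), the subalgebra of `B[t₁,…,tₙ]` generated by
`B` together with `φ(s₁),…,φ(sₙ)` is all of `B[t₁,…,tₙ]`. -/
def StronglyDetectable (k A : Type u) [Field k] [Ring A] [Algebra k A] : Prop :=
  ∀ (n : ℕ), 1 ≤ n → ∀ (B : Type u) [Ring B] [Algebra k B]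
    (φ : PolyExt A n ≃ₐ[k] PolyExt B n),
    Algebra.adjoin k
      (Set.range (PolyExt.C k B n) ∪ Set.range fun i => φ (PolyExt.X A n i)) = ⊤

/-- A surjective endomorphism of a Noetherian ring is injective. -/
lemma RingHom.injective_of_surjective_of_isNoetherianRing {R : Type*} [CommRing R]
    [IsNoetherianRing R] (f : R →+* R) (hf : Function.Surjective f) :
    Function.Injective f := by
  have hmono : Monotone fun n : ℕ => RingHom.ker (f ^ n) := by
    refine monotone_nat_of_le_succ fun n x hx => ?_
    rw [RingHom.mem_ker] at hx ⊢
    rw [pow_succ', RingHom.mul_def, RingHom.comp_apply, hx, map_zero]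
  obtain ⟨N, hN⟩ := monotone_stabilizes_iff_noetherian.mpr ‹IsNoetherianRing R› ⟨_, hmono⟩
  refine (injective_iff_map_eq_zero f).mpr fun x hx => ?_
  have hsurj : Function.Surjective (f ^ N) := by
    rw [RingHom.coe_pow]
    exact hf.iterate N
  obtain ⟨w, rfl⟩ := hsurj x
  have hw : w ∈ RingHom.ker (f ^ (N + 1)) := by
    rw [RingHom.mem_ker, pow_succ', RingHom.mul_def, RingHom.comp_apply, hx]
  have hker : RingHom.ker (f ^ N) = RingHom.ker (f ^ (N + 1)) := hN (N + 1) N.le_succ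
  rwa [← hker] at hw

namespace MvPolynomial

variable {σ R : Type*} [CommRing R]

/-- A surjective `R`-algebra endomorphism of a polynomial ring in finitely many variables
is injective, over any commutative ring `R`. -/
lemma injective_of_surjective_algHom [Finite σ]
    (f : MvPolynomial σ R →ₐ[R] MvPolynomial σ R) (hf : Function.Surjective f) :
    Function.Injective f := by
  classical
  cases nonempty_fintype σ
  refine (injective_iff_map_eq_zero f).mpr fun p hp => ?_
  choose g hg using fun i => hf (X i)
  let S : Finset R := p.coeffs ∪ (Finset.univ.biUnion fun i => (f (X i)).coeffs) ∪
    Finset.univ.biUnion fun i => (g i).coeffs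
  let R₀ := Algebra.adjoin ℤ (S : Set R)
  have : Algebra.FiniteType ℤ R₀ :=
    (Subalgebra.fg_iff_finiteType _).mp (Subalgebra.fg_adjoin_finset S)
  have : IsNoetherianRing R₀ := Algebra.FiniteType.isNoetherianRing ℤ R₀
  have lift (q : MvPolynomial σ R) (hq : q.coeffs ⊆ S) :
      ∃ q₀, map (algebraMap R₀ R) q₀ = q := by
    refine mem_range_map_iff_coeffs_subset.mpr fun c hc => ?_
    exact ⟨⟨c, Algebra.subset_adjoin (hq hc)⟩, rfl⟩
  obtain ⟨p₀, hp₀⟩ := lift p fun c hc => by simp [S, hc]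
  choose F hF using fun i => lift (f (X i)) fun c hc => by
    simp only [S, Finset.mem_union, Finset.mem_biUnion]
    exact .inl (.inr ⟨i, Finset.mem_univ _, hc⟩)
  choose G hG using fun i => lift (g i) fun c hc => by
    simp only [S, Finset.mem_union, Finset.mem_biUnion]
    exact .inr ⟨i, Finset.mem_univ _, hc⟩
  have hinj : Function.Injective (map (σ := σ) (algebraMap R₀ R)) :=
    map_injective _ Subtype.val_injective
  have hcomm (q : MvPolynomial σ R₀) :
      map (algebraMap R₀ R) (aeval F q) = f (map (algebraMap R₀ R) q) := by
    induction q using MvPolynomial.induction_on with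
    | C a => simp [algHom_C]
    | add a b ha hb => simp only [map_add, ha, hb]
    | mul_X a i ha => simp only [map_mul, ha, aeval_X, hF, map_X]
  have hFG : (aeval F).comp (aeval G) = AlgHom.id R₀ (MvPolynomial σ R₀) :=
    algHom_ext fun i => hinj (by simp only [AlgHom.comp_apply, aeval_X, hcomm, hG, hg,
      AlgHom.id_apply, map_X])
  have hFinj := RingHom.injective_of_surjective_of_isNoetherianRing
    (aeval F : MvPolynomial σ R₀ →ₐ[R₀] MvPolynomial σ R₀).toRingHom
    fun q => ⟨aeval G q, DFunLike.congr_fun hFG q⟩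
  have : p₀ = 0 := (injective_iff_map_eq_zero _).mp hFinj p₀
    (hinj (by simpa [hp₀, hp] using hcomm p₀))
  rw [← hp₀, this, map_zero]

/-- Non-constant coefficients of an idempotent polynomial are nilpotent. -/
lemma isNilpotent_coeff_of_isIdempotentElem {p : MvPolynomial σ R}
    (hp : IsIdempotentElem p) {d : σ →₀ ℕ} (hd : d ≠ 0) : IsNilpotent (p.coeff d) := by
  classical
  refine nilpotent_iff_mem_prime.mpr fun J hJ => ?_
  have h := hp.map (map (σ := σ) (Ideal.Quotient.mk J))
  rw [← Ideal.Quotient.eq_zero_iff_mem, ← coeff_map]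
  rcases IsIdempotentElem.iff_eq_zero_or_one.mp h with h | h <;> rw [h]
  · simp
  · rw [coeff_one, if_neg hd.symm]

/-- If every polynomial is congruent to an element of the image of an `R`-algebra endomorphism
modulo nilpotents, then this endomorphism is surjective. -/
lemma surjective_of_surjective_mod_nilpotent [Finite σ]
    (f : MvPolynomial σ R →ₐ[R] MvPolynomial σ R)
    (hf : ∀ i, ∃ q, IsNilpotent (X i - f q)) : Function.Surjective f := by
  classical
  cases nonempty_fintype σ
  choose q hq using hf
  let N : Ideal R := Ideal.span (Finset.univ.biUnion fun i => (X i - f (q i)).coeffs : Finset R)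
  have hNnil : IsNilpotent N := by
    refine (Ideal.FG.isNilpotent_iff_le_nilradical ⟨_, rfl⟩).mpr (Ideal.span_le.mpr ?_)
    intro c hc
    simp only [Finset.coe_biUnion, Set.mem_iUnion, Finset.mem_coe, mem_coeffs_iff] at hc
    obtain ⟨i, -, d, -, rfl⟩ := hc
    exact MvPolynomial.isNilpotent_iff.mp (hq i) d
  have hmem (i : σ) : X i - f (q i) ∈ N.map (C (σ := σ)) := by
    refine mem_map_C_iff.mpr fun d => ?_
    by_cases h : (X i - f (q i)).coeff d = 0
    · rw [h]; exact N.zero_mem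
    · refine Ideal.subset_span ?_
      simp only [Finset.coe_biUnion, Set.mem_iUnion, Finset.mem_coe]
      exact ⟨i, Finset.mem_univ i, coeff_mem_coeffs d h⟩
  have hstep (p : MvPolynomial σ R) : ∃ w, p - f w ∈ N.map (C (σ := σ)) := by
    induction p using MvPolynomial.induction_on with
    | C a => exact ⟨C a, by simp [algHom_C]⟩
    | add a b ha hb =>
      obtain ⟨v, hv⟩ := ha
      obtain ⟨w, hw⟩ := hb
      refine ⟨v + w, ?_⟩
      rw [map_add, add_sub_add_comm]
      exact add_mem hv hw
    | mul_X a i ha =>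
      obtain ⟨v, hv⟩ := ha
      refine ⟨v * q i, ?_⟩
      have : a * X i - f (v * q i) = X i * (a - f v) + f v * (X i - f (q i)) := by
        rw [map_mul]; ring
      rw [this]
      exact add_mem (Ideal.mul_mem_left _ _ hv) (Ideal.mul_mem_left _ _ (hmem i))
  let W : Submodule R (MvPolynomial σ R) := LinearMap.range f.toLinearMap
  have hW : (⊤ : Submodule R (MvPolynomial σ R)) ≤ W ⊔ N • ⊤ := by
    intro p _
    obtain ⟨w, hw⟩ := hstep p
    refine Submodule.mem_sup.mpr ⟨f w, ⟨w, rfl⟩, p - f w, ?_, add_sub_cancel _ _⟩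
    rw [Ideal.smul_top_eq_map]
    exact hw
  have hpow (k : ℕ) : (⊤ : Submodule R (MvPolynomial σ R)) ≤ W ⊔ N ^ k • ⊤ := by
    induction k with
    | zero =>
      rw [pow_zero, one_smul]
      exact le_sup_right
    | succ k ih =>
      refine ih.trans (sup_le le_sup_left ?_)
      calc N ^ k • (⊤ : Submodule R (MvPolynomial σ R)) ≤ N ^ k • (W ⊔ N • ⊤) :=
            smul_mono_right _ hW
        _ = N ^ k • W ⊔ N ^ (k + 1) • ⊤ := by
            rw [Submodule.smul_sup, ← mul_smul, pow_succ]
        _ ≤ W ⊔ N ^ (k + 1) • ⊤ := sup_le_sup_right Submodule.smul_le_right _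
  obtain ⟨k, hk⟩ := hNnil
  have htop := hpow k
  rw [hk, Submodule.zero_eq_bot, Submodule.bot_smul, sup_bot_eq] at htop
  intro p
  exact htop (Submodule.mem_top (x := p))

end MvPolynomial

namespace PolyExt

variable {A : Type u} [Ring A] {n : ℕ}

/-- Polynomials are generated by constants under addition and multiplication by indeterminates. -/
lemma induction {motive : PolyExt A n → Prop} (p : PolyExt A n)
    (C : ∀ a, motive (AddMonoidAlgebra.single 0 a))
    (add : ∀ p q, motive p → motive q → motive (p + q))
    (mul_X : ∀ p i, motive p → motive (p * PolyExt.X A n i)) : motive p := by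
  induction p using AddMonoidAlgebra.induction_linear with
  | zero => simpa using C 0
  | add p q hp hq => exact add p q hp hq
  | single d a =>
    have h (d d' : Fin n →₀ ℕ) (hd' : motive (AddMonoidAlgebra.single d' a)) :
        motive (AddMonoidAlgebra.single (d' + d) a) := by
      induction d using Finsupp.induction_linear generalizing d' with
      | zero => simpa using hd'
      | add d₁ d₂ h₁ h₂ =>
        rw [← add_assoc]
        exact h₂ _ (h₁ _ hd')
      | single i m =>
        induction m with
        | zero => simpa using hd'
        | succ m ih =>
          have := mul_X _ i ih
          rwa [PolyExt.X, AddMonoidAlgebra.single_mul_single, mul_one, add_assoc,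
            ← Finsupp.single_add] at this
    simpa using h d 0 (C a)

lemma commute_X (i : Fin n) (p : PolyExt A n) : Commute (PolyExt.X A n i) p := by
  induction p using AddMonoidAlgebra.induction_linear with
  | zero => exact Commute.zero_right _
  | add p q hp hq => exact hp.add_right hq
  | single d a =>
    rw [commute_iff_eq, PolyExt.X, AddMonoidAlgebra.single_mul_single,
      AddMonoidAlgebra.single_mul_single, add_comm, one_mul, mul_one]

/-- The kernel of a retraction of `A[t₁,…,tₙ]` onto the constants is generated by the elements
`tᵢ - yᵢ`, where `yᵢ` is the image of `tᵢ`. -/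
lemma ker_eq_span (ε : PolyExt A n →+* A) (hε : ∀ a, ε (AddMonoidAlgebra.single 0 a) = a) :
    RingHom.ker ε = Ideal.span (Set.range fun i =>
      PolyExt.X A n i - AddMonoidAlgebra.single 0 (ε (PolyExt.X A n i))) := by
  apply le_antisymm
  · suffices h : ∀ p, p - AddMonoidAlgebra.single 0 (ε p) ∈ Ideal.span (Set.range fun i =>
        PolyExt.X A n i - AddMonoidAlgebra.single 0 (ε (PolyExt.X A n i))) by
      intro p hp
      simpa [(RingHom.mem_ker).mp hp] using h p
    intro p
    induction p using PolyExt.induction with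
    | C a => simp [hε]
    | add p q hp hq =>
      rw [map_add, AddMonoidAlgebra.single_add, add_sub_add_comm]
      exact add_mem hp hq
    | mul_X p i hp =>
      have : p * PolyExt.X A n i - AddMonoidAlgebra.single 0 (ε (p * PolyExt.X A n i)) =
          PolyExt.X A n i * (p - AddMonoidAlgebra.single 0 (ε p)) +
          AddMonoidAlgebra.single 0 (ε p) * (PolyExt.X A n i -
            AddMonoidAlgebra.single 0 (ε (PolyExt.X A n i))) := by
        rw [mul_sub, mul_sub, (commute_X i p).eq, (commute_X i (AddMonoidAlgebra.single 0 (ε p))).eq,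
          AddMonoidAlgebra.single_mul_single, add_zero, ← map_mul]
        abel
      rw [this]
      exact add_mem (Ideal.mul_mem_left _ _ hp)
        (Ideal.mul_mem_left _ _ (Ideal.subset_span ⟨i, rfl⟩))
  · rw [Ideal.span_le]
    rintro _ ⟨i, rfl⟩
    simp [RingHom.mem_ker, hε]

end PolyExt

/-- Let every element of `Z` be a sum of a unit and an idempotent. Then an isomorphism
`Z[s₁,…,sₙ] ≃ Y[t₁,…,tₙ]` maps the ideal `(s₁,…,sₙ)` to the ideal of a `Y`-rational point. -/
lemma MvPolynomial.exists_span_eq_of_ringEquiv {Z Y : Type u} [CommRing Z] [CommRing Y] {n : ℕ}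
    (hZ : ∀ z : Z, ∃ v w : Z, IsUnit v ∧ IsIdempotentElem w ∧ z = v + w)
    (φ : MvPolynomial (Fin n) Z ≃+* MvPolynomial (Fin n) Y) :
    ∃ y : Fin n → Y, Ideal.span (Set.range fun i => φ (X i)) =
      Ideal.span (Set.range fun i => X i - C (y i)) := by
  let Ψ : MvPolynomial (Fin n) Y →ₐ[Y] MvPolynomial (Fin n) Y := aeval fun i => φ (X i)
  have hΨ (i : Fin n) : Ψ (X i) = φ (X i) := aeval_X _ i
  have hC (z : Z) : IsNilpotent (φ (C z) - C ((φ (C z)).coeff 0)) := by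
    classical
    refine MvPolynomial.isNilpotent_iff.mpr fun d => ?_
    rw [coeff_sub, coeff_C]
    split_ifs with hd
    · simp [← hd]
    · obtain ⟨v, w, hv, hw, rfl⟩ := hZ z
      rw [sub_zero, map_add, map_add, coeff_add]
      refine (Commute.all _ _).isNilpotent_add ?_ ?_
      · exact (MvPolynomial.isUnit_iff.mp ((hv.map C).map φ)).2 d (Ne.symm hd)
      · exact isNilpotent_coeff_of_isIdempotentElem ((hw.map C).map φ) (Ne.symm hd)
  have hmod (p : MvPolynomial (Fin n) Z) : ∃ q, IsNilpotent (φ p - Ψ q) := by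
    induction p using MvPolynomial.induction_on with
    | C z => exact ⟨C ((φ (C z)).coeff 0), by simpa [Ψ, algHom_C] using hC z⟩
    | add a b ha hb =>
      obtain ⟨v, hv⟩ := ha
      obtain ⟨w, hw⟩ := hb
      refine ⟨v + w, ?_⟩
      rw [map_add, map_add, add_sub_add_comm]
      exact (Commute.all _ _).isNilpotent_add hv hw
    | mul_X a i ha =>
      obtain ⟨v, hv⟩ := ha
      refine ⟨v * X i, ?_⟩
      have : φ (a * X i) - Ψ (v * X i) = (φ a - Ψ v) * φ (X i) := by
        rw [map_mul, map_mul, hΨ, sub_mul]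
      rw [this]
      exact (Commute.all _ _).isNilpotent_mul_right hv
  have hsurj : Function.Surjective Ψ := surjective_of_surjective_mod_nilpotent Ψ fun i => by
    simpa using hmod (φ.symm (X i))
  let Ψe := AlgEquiv.ofBijective Ψ ⟨injective_of_surjective_algHom Ψ hsurj, hsurj⟩
  let ε₀ : MvPolynomial (Fin n) Y →ₐ[Y] Y := aeval 0
  let ε : MvPolynomial (Fin n) Y →ₐ[Y] Y := ε₀.comp Ψe.symm.toAlgHom
  refine ⟨fun i => ε (X i), ?_⟩
  have h₀ : RingHom.ker ε₀.toRingHom = Ideal.span (Set.range X) := by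
    rw [PolyExt.ker_eq_span ε₀.toRingHom fun a => ε₀.commutes a]
    congr 2
    ext1 i
    have : ε₀.toRingHom (X i) = 0 := aeval_X _ i
    change X i - C (ε₀.toRingHom (X i)) = X i
    rw [this, map_zero, sub_zero]
  have h₁ : RingHom.ker ε.toRingHom = Ideal.span (Set.range fun i => X i - C (ε (X i))) :=
    PolyExt.ker_eq_span ε.toRingHom fun a => ε.commutes a
  have h₂ : (RingHom.ker ε₀.toRingHom).map Ψe.toRingEquiv = RingHom.ker ε.toRingHom :=
    (Ideal.comap_symm Ψe.toRingEquiv).symm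
  rw [← h₁, ← h₂, h₀, Ideal.map_span, ← Set.range_comp]
  congr 2
  ext1 i
  exact (hΨ i).symm

namespace PolyExt

variable (A : Type u) [Ring A] (n : ℕ)

/-- The inclusion of the polynomial ring over the center of `A` into `A[t₁,…,tₙ]`. -/
noncomputable def ofCenter : MvPolynomial (Fin n) (Subring.center A) →+* PolyExt A n :=
  AddMonoidAlgebra.mapRingHom _ (Subring.center A).subtype

variable {A n}

lemma ofCenter_X (i : Fin n) : ofCenter A n (MvPolynomial.X i) = PolyExt.X A n i :=
  AddMonoidAlgebra.mapRingHom_single ..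

lemma ofCenter_C (z : Subring.center A) :
    ofCenter A n (MvPolynomial.C z) = AddMonoidAlgebra.single 0 (z : A) :=
  AddMonoidAlgebra.mapRingHom_single ..

lemma ofCenter_injective : Function.Injective (ofCenter A n) := by
  intro p q h
  refine MvPolynomial.ext _ _ fun d => Subtype.ext ?_
  simpa [ofCenter, MvPolynomial.coeff] using congr(AddMonoidAlgebra.coeff $h d)

lemma mem_center_iff_forall_coeff {p : PolyExt A n} :
    p ∈ Subring.center (PolyExt A n) ↔ ∀ d, p.coeff d ∈ Subring.center A := by
  simp only [Subring.mem_center_iff]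
  constructor
  · intro h d a
    have := congr(AddMonoidAlgebra.coeff $(h (AddMonoidAlgebra.single 0 a)) d)
    simpa [AddMonoidAlgebra.coeff_single_zero_mul, AddMonoidAlgebra.coeff_mul_single_zero] using this
  · intro h q
    induction q using PolyExt.induction with
    | C a =>
      ext d
      simpa [AddMonoidAlgebra.coeff_single_zero_mul, AddMonoidAlgebra.coeff_mul_single_zero]
        using h d a
    | add q r hq hr => rw [add_mul, mul_add, hq, hr]
    | mul_X q i hq => rw [mul_assoc, (commute_X i p).eq, ← mul_assoc, hq, mul_assoc]

lemma mem_range_ofCenter_iff {p : PolyExt A n} :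
    (∃ q, ofCenter A n q = p) ↔ p ∈ Subring.center (PolyExt A n) := by
  rw [mem_center_iff_forall_coeff]
  constructor
  · rintro ⟨q, rfl⟩ d
    simp [ofCenter]
  · intro h
    refine ⟨AddMonoidAlgebra.ofCoeff (Finsupp.onFinset p.coeff.support
      (fun d => ⟨p.coeff d, h d⟩) fun d hd => ?_), ?_⟩
    · rw [Finsupp.mem_support_iff]
      exact fun h0 => hd (Subtype.ext h0)
    · ext d
      simp [ofCenter]

variable (A n)

/-- The center of `A[t₁,…,tₙ]` is the polynomial ring over the center of `A`. -/
noncomputable def centerEquiv :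
    MvPolynomial (Fin n) (Subring.center A) ≃+* Subring.center (PolyExt A n) :=
  RingEquiv.ofBijective
    ((ofCenter A n).codRestrict _ fun q => mem_range_ofCenter_iff.mp ⟨q, rfl⟩)
    ⟨fun _ _ h => ofCenter_injective (congrArg Subtype.val h), fun p => by
      obtain ⟨q, hq⟩ := mem_range_ofCenter_iff.mpr p.2
      exact ⟨q, Subtype.ext hq⟩⟩

variable {A n}

/-- Evaluation of a polynomial over `A` at a tuple of central elements. -/
noncomputable def evalCenter (y : Fin n → Subring.center A) : PolyExt A n →+* A :=
  AddMonoidAlgebra.liftNCRingHom (RingHom.id A)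
    (((Subring.center A).subtype.comp (MvPolynomial.eval y)).toMonoidHom.comp
      (AddMonoidAlgebra.of (Subring.center A) (Fin n →₀ ℕ)))
    fun a d => Subring.mem_center_iff.mp
      (MvPolynomial.eval y (AddMonoidAlgebra.of (Subring.center A) (Fin n →₀ ℕ) d)).2 a

lemma evalCenter_C (y : Fin n → Subring.center A) (a : A) :
    evalCenter y (AddMonoidAlgebra.single 0 a) = a := by
  have : (AddMonoidAlgebra.single 0 1 : MvPolynomial (Fin n) (Subring.center A)) = 1 := rfl
  simp [evalCenter, this]

lemma evalCenter_X (y : Fin n → Subring.center A) (i : Fin n) :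
    evalCenter y (PolyExt.X A n i) = y i := by
  have : (AddMonoidAlgebra.single (Finsupp.single i 1) 1 :
    MvPolynomial (Fin n) (Subring.center A)) = MvPolynomial.X i := rfl
  simp [evalCenter, PolyExt.X, this]

lemma ker_evalCenter (y : Fin n → Subring.center A) : RingHom.ker (evalCenter y) =
    Ideal.span (Set.range fun i => PolyExt.X A n i - AddMonoidAlgebra.single 0 (y i : A)) := by
  simpa only [evalCenter_X] using ker_eq_span (evalCenter y) (evalCenter_C y)

end PolyExt

namespace PolyExt

variable {A B : Type u} [Ring A] [Ring B] {n : ℕ}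

lemma X_mem_center (i : Fin n) : PolyExt.X A n i ∈ Subring.center (PolyExt A n) :=
  Subring.mem_center_iff.mpr fun p => (commute_X i p).eq.symm

lemma ker_evalCenter_zero :
    RingHom.ker (evalCenter (0 : Fin n → Subring.center A)) =
      Ideal.span (Set.range (PolyExt.X A n)) := by
  rw [ker_evalCenter]
  simp

/-- An isomorphism between the centers of `A[s₁,…,sₙ]` and `B[t₁,…,tₙ]` maps the `sᵢ` to generators
of the kernel of an evaluation map `B[t₁,…,tₙ] → B` at central elements, if the center of `A`
is a clean ring. -/
lemma exists_span_eq_ker_evalCenter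
    (hA : ∀ z : Subring.center A, ∃ v w : Subring.center A,
      IsUnit v ∧ IsIdempotentElem w ∧ z = v + w)
    (φ : Subring.center (PolyExt A n) ≃+* Subring.center (PolyExt B n)) :
    ∃ y : Fin n → Subring.center B,
      Ideal.span (Set.range fun i => (φ ⟨PolyExt.X A n i, X_mem_center i⟩ : PolyExt B n)) =
        RingHom.ker (evalCenter y) := by
  obtain ⟨y, hy⟩ := MvPolynomial.exists_span_eq_of_ringEquiv hA
    ((centerEquiv A n).trans (φ.trans (centerEquiv B n).symm))
  refine ⟨y, ?_⟩
  have h := congrArg (Ideal.map (ofCenter B n)) hy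
  rw [Ideal.map_span, Ideal.map_span, ← Set.range_comp, ← Set.range_comp] at h
  rw [ker_evalCenter]
  convert h using 3
  · ext1 i
    have h₁ : centerEquiv A n (MvPolynomial.X i) = ⟨PolyExt.X A n i, X_mem_center i⟩ :=
      Subtype.ext (ofCenter_X i)
    have h₂ (p : Subring.center (PolyExt B n)) :
        ofCenter B n ((centerEquiv B n).symm p) = p :=
      congrArg Subtype.val ((centerEquiv B n).apply_symm_apply p)
    simp [h₁, h₂]
  · ext1 i
    simp [ofCenter_X, ofCenter_C]

end PolyExt

/-- A finite product of local rings is a clean ring. -/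
lemma exists_isUnit_add_isIdempotentElem {ι : Type*} {Z : ι → Type*} [∀ i, CommRing (Z i)]
    [∀ i, IsLocalRing (Z i)] (z : ∀ i, Z i) :
    ∃ v w : ∀ i, Z i, IsUnit v ∧ IsIdempotentElem w ∧ z = v + w := by
  have h (i : ι) : ∃ v w : Z i, IsUnit v ∧ IsIdempotentElem w ∧ z i = v + w := by
    rcases IsLocalRing.isUnit_or_isUnit_one_sub_self (z i) with hz | hz
    · exact ⟨z i, 0, hz, IsIdempotentElem.zero, (add_zero _).symm⟩
    · exact ⟨z i - 1, 1, by simpa using hz.neg, IsIdempotentElem.one, (sub_add_cancel _ _).symm⟩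
  choose v w hv hw hz using h
  exact ⟨v, w, Pi.isUnit_iff.mpr hv, funext hw, funext hz⟩

lemma exists_isUnit_add_isIdempotentElem_of_ringEquiv {R S : Type*} [Ring R] [Ring S]
    (e : R ≃+* S) (hS : ∀ z : S, ∃ v w : S, IsUnit v ∧ IsIdempotentElem w ∧ z = v + w) (z : R) :
    ∃ v w : R, IsUnit v ∧ IsIdempotentElem w ∧ z = v + w := by
  obtain ⟨v, w, hv, hw, h⟩ := hS (e z)
  refine ⟨e.symm v, e.symm w, hv.map e.symm, hw.map e.symm, ?_⟩
  rw [← map_add, ← h, e.symm_apply_apply]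

lemma stronglyCancellative_of_clean_center (k A : Type u) [Field k] [Ring A] [Algebra k A]
    (hA : ∀ z : Subring.center A, ∃ v w : Subring.center A,
      IsUnit v ∧ IsIdempotentElem w ∧ z = v + w) :
    StronglyCancellative k A := by
  rintro n - B _ _ ⟨Φ⟩
  obtain ⟨y, hy⟩ := PolyExt.exists_span_eq_ker_evalCenter hA (Subring.centerCongr Φ.toRingEquiv)
  let ε₀ := PolyExt.evalCenter (0 : Fin n → Subring.center A)
  let ε := PolyExt.evalCenter y
  have hker (p : PolyExt A n) : ε (Φ p) = 0 ↔ ε₀ p = 0 := by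
    rw [← RingHom.mem_ker, ← RingHom.mem_ker, PolyExt.ker_evalCenter_zero, ← hy]
    change _ ∈ Ideal.span (Set.range (Φ.toRingEquiv ∘ PolyExt.X A n)) ↔ _
    rw [Set.range_comp, ← Ideal.map_span]
    exact Ideal.apply_mem_of_equiv_iff
  let f : A →ₐ[k] B :=
    { ε.comp (Φ.toRingEquiv.toRingHom.comp (PolyExt.C k A n).toRingHom) with
      commutes' := fun c => by
        change ε (Φ (PolyExt.C k A n (algebraMap k A c))) = _
        rw [AlgHom.commutes, AlgEquiv.commutes, ← (PolyExt.C k B n).commutes]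
        exact PolyExt.evalCenter_C y _ }
  have hf (a : A) : f a = ε (Φ (PolyExt.C k A n a)) := rfl
  have hε₀ (a : A) : ε₀ (PolyExt.C k A n a) = a := PolyExt.evalCenter_C _ _
  refine ⟨AlgEquiv.ofBijective f ⟨(injective_iff_map_eq_zero f).mpr fun a ha => ?_, fun b => ?_⟩⟩
  · rwa [hf, hker, hε₀] at ha
  · refine ⟨ε₀ (Φ.symm (PolyExt.C k B n b)), ?_⟩
    have h : ε (Φ (PolyExt.C k A n (ε₀ (Φ.symm (PolyExt.C k B n b))) -
        Φ.symm (PolyExt.C k B n b))) = 0 := by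
      rw [hker, map_sub, hε₀, sub_self]
    rw [map_sub, map_sub, Φ.apply_symm_apply, sub_eq_zero] at h
    exact h.trans (PolyExt.evalCenter_C y b)

section Morita

open CategoryTheory

/-- The element of the center of the category of `R`-modules given by a central element of `R`. -/
def Subring.center.toCatCenter {R : Type u} [Ring R] (z : Subring.center R) :
    CatCenter (ModuleCat.{u} R) where
  app M := ModuleCat.ofHom
    { toFun := fun m => (z : R) • m
      map_add' := smul_add _
      map_smul' := fun r m => by
        rw [RingHom.id_apply, smul_smul, smul_smul, Subring.mem_center_iff.mp z.2 r] }
  naturality M N f := by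
    ext m
    exact (map_smul f.hom (z : R) m).symm

lemma Subring.center.toCatCenter_app_apply {R : Type u} [Ring R] (z : Subring.center R)
    (M : ModuleCat.{u} R) (m : M) : (toCatCenter z).app M m = (z : R) • m := rfl

/-- The center of a ring is the center of its category of modules. -/
noncomputable def Subring.centerRingEquivCatCenter (R : Type u) [Ring R] :
    Subring.center R ≃+* CatCenter (ModuleCat.{u} R) := by
  refine RingEquiv.ofBijective (⟨⟨⟨Subring.center.toCatCenter, ?_⟩, ?_⟩, ?_, ?_⟩ :
    Subring.center R →+* CatCenter (ModuleCat.{u} R)) ⟨?_, ?_⟩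
  · ext M m
    exact one_smul R m
  · intro z w
    ext M m
    exact mul_smul (z : R) (w : R) m
  · ext M m
    exact zero_smul R m
  · intro z w
    ext M m
    exact add_smul (z : R) (w : R) m
  · intro z w h
    have h₁ := congr(($h).app (ModuleCat.of R R) (1 : R))
    refine Subtype.ext ?_
    simpa using (Subring.center.toCatCenter_app_apply z (ModuleCat.of R R) (1 : R)).symm.trans
      (h₁.trans (Subring.center.toCatCenter_app_apply w (ModuleCat.of R R) (1 : R)))
  · intro η
    let z : R := η.app (ModuleCat.of R R) (1 : R)
    have hη (M : ModuleCat.{u} R) (m : M) : η.app M m = z • m := by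
      have h := η.naturality (ModuleCat.ofHom (LinearMap.toSpanSingleton R M m))
      have h₁ := congr($h (1 : R))
      have h₂ : η.app M ((1 : R) • m) = z • m := h₁
      rwa [one_smul] at h₂
    refine ⟨⟨z, Subring.mem_center_iff.mpr fun r => ?_⟩, ?_⟩
    · have h := hη (ModuleCat.of R R) (r • (1 : R))
      rw [map_smul] at h
      simpa using h
    · ext M m
      exact (hη M m).symm

/-- An equivalence of categories of modules induces an isomorphism of centers which is compatible
with annihilation of modules. -/
lemma exists_center_ringEquiv_of_equivalence {R S : Type u} [Ring R] [Ring S]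
    (e : ModuleCat.{u} R ≌ ModuleCat.{u} S) :
    ∃ φ : Subring.center R ≃+* Subring.center S, ∀ (z : Subring.center R) (M : ModuleCat.{u} R),
      (∀ m : e.functor.obj M, (φ z : S) • m = 0) ↔ ∀ m : M, (z : R) • m = 0 := by
  have : e.functor.Additive := e.functor.additive_of_preserves_binary_products
  have : e.functor.IsLocalization (MorphismProperty.isomorphisms _) :=
    inferInstanceAs ((𝟭 _ ⋙ e.functor).IsLocalization (MorphismProperty.isomorphisms _))
  let L : CatCenter (ModuleCat.{u} R) →+* CatCenter (ModuleCat.{u} S) :=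
    CatCenter.localizationRingHom e.functor (MorphismProperty.isomorphisms _)
  have hL (η : CatCenter (ModuleCat.{u} R)) (M : ModuleCat.{u} R) :
      (L η).app (e.functor.obj M) = e.functor.map (η.app M) :=
    CatCenter.localization_app η e.functor (MorphismProperty.isomorphisms _) M
  have hbij : Function.Bijective L := by
    refine ⟨(injective_iff_map_eq_zero L).mpr fun η hη => ?_, fun θ => ?_⟩
    · refine CatCenter.ext _ _ fun M => e.functor.map_injective ?_
      rw [← hL, hη]
      exact e.functor.map_zero _ _ |>.symm
    · let η : CatCenter (ModuleCat.{u} R) :=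
        { app := fun M => e.functor.preimage (θ.app (e.functor.obj M))
          naturality := fun M N f => e.functor.map_injective (by
            simpa using θ.naturality (e.functor.map f)) }
      refine ⟨η, CatCenter.ext_of_localization e.functor
        (MorphismProperty.isomorphisms _) _ _ fun M => ?_⟩
      rw [hL]
      exact e.functor.map_preimage _
  have happ {R : Type u} [Ring R] (z : Subring.center R) (M : ModuleCat.{u} R) :
      (∀ m : M, (z : R) • m = 0) ↔ (Subring.centerRingEquivCatCenter R z).app M = 0 :=
    ⟨fun h => ModuleCat.hom_ext (LinearMap.ext h), fun h m => congr($h m)⟩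
  refine ⟨(Subring.centerRingEquivCatCenter R).trans ((RingEquiv.ofBijective L hbij).trans
    (Subring.centerRingEquivCatCenter S).symm), fun z M => ?_⟩
  rw [happ, happ, RingEquiv.trans_apply, RingEquiv.trans_apply, RingEquiv.apply_symm_apply,
    RingEquiv.ofBijective_apply, hL]
  exact e.functor.map_eq_zero_iff

/-- Let `f : R → A` be a surjective ring homomorphism. A module over `R` comes from a module
over `A` if and only if it is annihilated by the kernel of `f`. -/
lemma ModuleCat.essImage_restrictScalars_iff {R A : Type u} [Ring R] [Ring A] (f : R →+* A)
    (hf : Function.Surjective f) (M : ModuleCat.{u} R) :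
    (ModuleCat.restrictScalars.{u} f).essImage M ↔ RingHom.ker f ≤ Module.annihilator R M := by
  constructor
  · rintro ⟨N, ⟨i⟩⟩ r hr
    refine Module.mem_annihilator.mpr fun m => ?_
    obtain ⟨x, rfl⟩ := i.toLinearEquiv.surjective m
    rw [← map_smul]
    have : r • x = 0 := by
      change f r • (show N from x) = 0
      rw [RingHom.mem_ker.mp hr, zero_smul]
    rw [this, map_zero]
  · intro h
    let g : A →+* AddMonoid.End M := f.liftOfSurjective hf
      ⟨Module.toAddMonoidEnd R M, fun r hr => AddMonoidHom.ext fun m =>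
        Module.mem_annihilator.mp (h hr) m⟩
    have hg (r : R) : g (f r) = Module.toAddMonoidEnd R M r :=
      f.liftOfRightInverse_comp_apply _ _ _ r
    let _ : Module A M := Module.compHom M g
    let N : ModuleCat.{u} R := (ModuleCat.restrictScalars f).obj (ModuleCat.of A M)
    let l : N ≃ₗ[R] M :=
      { toFun := fun m => m
        invFun := fun m => m
        map_add' := fun _ _ => rfl
        map_smul' := fun r m => DFunLike.congr_fun (hg r) (show M from m) }
    exact ⟨ModuleCat.of A M, ⟨l.toModuleIso⟩⟩

lemma ModuleCat.full_restrictScalars {R A : Type u} [Ring R] [Ring A] (f : R →+* A)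
    (hf : Function.Surjective f) : (ModuleCat.restrictScalars.{u} f).Full where
  map_surjective {M N} g := by
    refine ⟨ModuleCat.ofHom
      { toFun := fun m => g.hom m
        map_add' := g.hom.map_add
        map_smul' := fun a m => ?_ }, rfl⟩
    obtain ⟨r, rfl⟩ := hf a
    exact g.hom.map_smul r m

/-- Cancellation of polynomial variables for equivalences of categories of left modules. -/
lemma nonempty_moduleCat_equivalence_of_clean_center {A B : Type u} [Ring A] [Ring B] {n : ℕ}
    (hA : ∀ z : Subring.center A, ∃ v w : Subring.center A,
      IsUnit v ∧ IsIdempotentElem w ∧ z = v + w)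
    (e : ModuleCat.{u} (PolyExt A n) ≌ ModuleCat.{u} (PolyExt B n)) :
    Nonempty (ModuleCat.{u} A ≌ ModuleCat.{u} B) := by
  obtain ⟨φ, hφ⟩ := exists_center_ringEquiv_of_equivalence e
  obtain ⟨y, hy⟩ := PolyExt.exists_span_eq_ker_evalCenter hA φ
  let ε₀ := PolyExt.evalCenter (0 : Fin n → Subring.center A)
  let ε := PolyExt.evalCenter y
  have hε₀ : Function.Surjective ε₀ := fun a => ⟨_, PolyExt.evalCenter_C _ a⟩
  have hε : Function.Surjective ε := fun b => ⟨_, PolyExt.evalCenter_C _ b⟩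
  let F := ModuleCat.restrictScalars.{u} ε₀
  let G := ModuleCat.restrictScalars.{u} ε
  have : F.Full := ModuleCat.full_restrictScalars ε₀ hε₀
  have : G.Full := ModuleCat.full_restrictScalars ε hε
  have h : G.essImage.inverseImage e.functor = F.essImage := by
    ext M
    rw [ObjectProperty.prop_inverseImage_iff, ModuleCat.essImage_restrictScalars_iff ε₀ hε₀,
      ModuleCat.essImage_restrictScalars_iff ε hε, ← hy, PolyExt.ker_evalCenter_zero,
      Ideal.span_le, Ideal.span_le, Set.range_subset_iff, Set.range_subset_iff]
    refine forall_congr' fun i => ?_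
    rw [SetLike.mem_coe, SetLike.mem_coe, Module.mem_annihilator, Module.mem_annihilator]
    exact hφ ⟨PolyExt.X A n i, PolyExt.X_mem_center i⟩ M
  exact ⟨F.toEssImage.asEquivalence.trans
    ((e.congrFullSubcategory h).trans G.toEssImage.asEquivalence.symm)⟩

/-- The opposite of `A[t₁,…,tₙ]` is the polynomial extension of the opposite of `A`. -/
noncomputable def PolyExt.opRingEquiv (A : Type u) [Ring A] (n : ℕ) :
    (PolyExt A n)ᵐᵒᵖ ≃+* PolyExt Aᵐᵒᵖ n :=
  AddMonoidAlgebra.opRingEquiv.trans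
    (AddMonoidAlgebra.mapDomainRingEquiv Aᵐᵒᵖ AddOpposite.opAddEquiv.symm)

lemma stronglyMoritaCancellative_of_clean_center (k A : Type u) [Field k] [Ring A] [Algebra k A]
    (hA : ∀ z : Subring.center A, ∃ v w : Subring.center A,
      IsUnit v ∧ IsIdempotentElem w ∧ z = v + w) :
    StronglyMoritaCancellative k A := by
  rintro n - B _ _ ⟨e⟩
  refine nonempty_moduleCat_equivalence_of_clean_center (n := n)
    (exists_isUnit_add_isIdempotentElem_of_ringEquiv Subring.centerToMulOpposite.symm hA) ?_
  exact (ModuleCat.restrictScalarsEquivalenceOfRingEquiv (PolyExt.opRingEquiv A n)).trans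
    (e.trans (ModuleCat.restrictScalarsEquivalenceOfRingEquiv (PolyExt.opRingEquiv B n)).symm)

end Morita

/-- If the center of `A` is isomorphic as a `k`-algebra to a finite
direct product of commutative local `k`-algebras, then `A` is strongly cancellative
and strongly Morita cancellative. -/
theorem strongly_cancellative_of_center_finite_product_of_local
    (k A : Type u) [Field k] [Ring A] [Algebra k A]
    (m : ℕ) (Z : Fin m → Type u) [∀ i, CommRing (Z i)] [∀ i, Algebra k (Z i)]
    [∀ i, IsLocalRing (Z i)]
    (e : Subalgebra.center k A ≃ₐ[k] ∀ i, Z i) :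
    StronglyCancellative k A ∧ StronglyMoritaCancellative k A := by
  have hA : ∀ z : Subring.center A, ∃ v w : Subring.center A,
      IsUnit v ∧ IsIdempotentElem w ∧ z = v + w :=
    exists_isUnit_add_isIdempotentElem_of_ringEquiv (R := Subalgebra.center k A) e.toRingEquiv
      exists_isUnit_add_isIdempotentElem
  exact ⟨stronglyCancellative_of_clean_center k A hA,
    stronglyMoritaCancellative_of_clean_center k A hA⟩
end

section
/- Let A be a k-algebra with center Z, and let D denote either Z or Z/N(Z). Suppose D is an integral domain, there exists a subfield K of D such that D has transcendence degree one over K, and D is not isomorphic as a k-algebra to a polynomial ring k'[x] for any field extension k' of k with k ⊆ k' ⊆ D. Then D is strongly retractable, and consequently A is strongly cancellative and strongly Morita cancellative. -/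
open scoped TensorProduct

universe u

/-- The hypothesis of Corollary 2.2(1): `D` is an integral domain of transcendence
degree one over some subfield `K ⊆ D`, and `D` is not isomorphic as a `k`-algebra to
a polynomial ring `k'[x]` for any field extension `k'` of `k` with `k ⊆ k' ⊆ D`. -/
def DomainTrdegOneNotPolynomial (k D : Type u) [Field k] [CommRing D] [Algebra k D] :
    Prop :=
  IsDomain D ∧
  (∃ K : Subring D, IsField K ∧ ∃ x : D, IsTranscendenceBasis K (fun _ : Unit => x)) ∧
  ¬ ∃ K' : Subalgebra k D, IsField K' ∧ Nonempty (D ≃ₐ[k] Polynomial K')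

section
open Polynomial

theorem exists_forall_eq_comp_of_mem_subfield {F M : Type*} [Field F] [Field M] [Algebra F[X] M]
    [IsFractionRing F[X] M] (L : Subfield M) (hF : ∀ a : F, algebraMap F[X] M (C a) ∈ L)
    (f : F[X]) (hf : algebraMap F[X] M f ∈ L) (hf0 : 0 < f.natDegree) :
    ∃ z : F[X], 0 < z.natDegree ∧ algebraMap F[X] M z ∈ L ∧
      ∀ g : F[X], algebraMap F[X] M g ∈ L → ∃ P : F[X], g = P.comp z := by
  have hinj : Function.Injective (algebraMap F[X] M) := IsFractionRing.injective F[X] M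
  set t : M := algebraMap F[X] M X with ht
  let i : F →+* L := ((algebraMap F[X] M).comp C).codRestrict L hF
  let G : (g : F[X]) → algebraMap F[X] M g ∈ L → L[X] := fun g hg => g.map i - C ⟨_, hg⟩
  have hGt : ∀ g hg, aeval t (G g hg) = 0 := by
    intro g hg
    simp only [G, map_sub, aeval_C, sub_eq_zero]
    rw [aeval_def, eval₂_map]
    have : (algebraMap L M).comp i = (algebraMap F[X] M).comp C := rfl
    rw [this, ht, ← hom_eval₂, eval₂_C_X]
    rfl
  have hGm : ∀ g hg, (G g hg).map (algebraMap L M) =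
      (g.map (C : F →+* F[X]) - C g).map (algebraMap F[X] M) := by
    intro g hg
    simp only [G, Polynomial.map_sub, Polynomial.map_map, map_C]
    rfl
  -- integrality of t over L
  have hG0 : G f hf ≠ 0 := by
    intro h
    have h1 := hGm f hf
    rw [h, Polynomial.map_zero] at h1
    have h2 := (Polynomial.map_eq_zero_iff hinj).1 h1.symm
    have h3 : (f.map (C : F →+* F[X])) = C f := sub_eq_zero.1 h2
    have h4 : f.natDegree = 0 := by
      rw [← natDegree_map_eq_of_injective (C_injective (R := F)) f, h3, natDegree_C]
    omega
  have hint : IsIntegral L t := isAlgebraic_iff_isIntegral.1 ⟨G f hf, hG0, hGt f hf⟩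
  set μ := minpoly L t with hμ
  have hμm : μ.Monic := minpoly.monic hint
  have hdvd : ∀ g hg, μ ∣ G g hg := fun g hg => minpoly.dvd L t (hGt g hg)
  obtain ⟨μ', hμ'⟩ : ∃ μ' : F[X][X], μ'.map (algebraMap F[X] M) = μ.map (algebraMap L M) := by
    have hc : (C f.leadingCoeff⁻¹ * f).Monic := by
      rw [mul_comm]; exact monic_mul_leadingCoeff_inv (by rintro rfl; simp at hf0)
    have hd : 0 < (C f.leadingCoeff⁻¹ * f).natDegree := by
      rw [natDegree_C_mul (by
        simp only [ne_eq, inv_eq_zero, leadingCoeff_eq_zero]; rintro rfl; simp at hf0)]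
      exact hf0
    set f1 := C f.leadingCoeff⁻¹ * f with hf1
    have hf1L : algebraMap F[X] M f1 ∈ L := by
      rw [hf1, map_mul]; exact L.mul_mem (hF _) hf
    have hmon : (f1.map (C : F →+* F[X]) - C f1).Monic := by
      apply (hc.map _).sub_of_left
      rw [degree_map_eq_of_injective (C_injective (R := F))]
      exact lt_of_le_of_lt degree_C_le (natDegree_pos_iff_degree_pos.1 hd)
    have := Polynomial.map_dvd (algebraMap L M) (hdvd f1 hf1L)
    rw [hGm] at this
    obtain ⟨g', hg'⟩ := IsIntegrallyClosed.eq_map_mul_C_of_dvd M hmon this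
    refine ⟨g', ?_⟩
    rw [(hμm.map (algebraMap L M)).leadingCoeff] at hg'
    simpa using hg'
  have hμ'm : μ'.Monic := by
    apply monic_of_injective hinj
    rw [hμ']
    exact hμm.map _
  have hz : ∀ j, algebraMap F[X] M (μ'.coeff j) = μ.coeff j := by
    intro j
    have := congrArg (fun p => p.coeff j) hμ'
    simp only [coeff_map] at this
    exact this
  have hzX : X ∣ μ'.coeff 0 := by
    have h1 : μ'.eval X = 0 := by
      apply hinj
      rw [map_zero, ← eval_map_apply, hμ', ← ht, eval_map_algebraMap]
      exact minpoly.aeval L t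
    have h2 : μ'.eval X = X * μ'.divX.eval X + μ'.coeff 0 := by
      conv_lhs => rw [← X_mul_divX_add μ', eval_add, eval_mul, eval_X, eval_C]
    rw [h1] at h2
    exact ⟨-μ'.divX.eval X, by linear_combination -h2⟩
  have hz0 : μ'.coeff 0 ≠ 0 := by
    intro h
    have h1 := hz 0
    rw [h, map_zero] at h1
    refine minpoly.coeff_zero_ne_zero hint ?_ (Subtype.ext h1.symm)
    rw [ht]
    exact fun h => X_ne_zero (hinj (h.trans (map_zero _).symm))
  have hzdeg : 0 < (μ'.coeff 0).natDegree := by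
    have := natDegree_le_of_dvd hzX hz0
    rwa [natDegree_X] at this
  refine ⟨μ'.coeff 0, hzdeg, by rw [hz]; exact SetLike.coe_mem _, ?_⟩
  intro g
  induction hn : g.natDegree using Nat.strong_induction_on generalizing g with
  | _ n ih =>
  intro hg
  by_cases hgd : g.natDegree = 0
  · refine ⟨g, ?_⟩
    rw [eq_C_of_natDegree_eq_zero hgd]; simp
  obtain ⟨q, hq⟩ := hdvd g hg
  obtain ⟨q', hq'⟩ : μ' ∣ g.map (C : F →+* F[X]) - C g := by
    rw [← map_dvd_map _ hinj hμ'm, ← hGm g hg, hμ']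
    exact Polynomial.map_dvd _ (hdvd g hg)
  have hqq : q'.map (algebraMap F[X] M) = q.map (algebraMap L M) := by
    apply mul_left_cancel₀ (hμm.map (algebraMap L M)).ne_zero
    rw [← Polynomial.map_mul, ← hq, hGm g hg, hq', Polynomial.map_mul, hμ']
  have hqL : algebraMap F[X] M (q'.coeff 0) ∈ L := by
    have := congrArg (fun p => p.coeff 0) hqq
    simp only [coeff_map] at this
    rw [this]; exact SetLike.coe_mem _
  have h0 : C (g.coeff 0) - g = μ'.coeff 0 * q'.coeff 0 := by
    have := congrArg (fun p => p.coeff 0) hq'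
    simpa [mul_coeff_zero] using this
  have hq0 : q'.coeff 0 ≠ 0 := by
    intro h
    rw [h, mul_zero, sub_eq_zero] at h0
    apply hgd
    rw [← h0, natDegree_C]
  have hdeg : (q'.coeff 0).natDegree < n := by
    have h1 : (C (g.coeff 0) - g).natDegree = g.natDegree := by
      rw [← neg_sub, natDegree_neg, natDegree_sub_C]
    rw [h0, natDegree_mul hz0 hq0] at h1
    omega
  obtain ⟨P, hP⟩ := ih _ hdeg _ rfl hqL
  refine ⟨C (g.coeff 0) - X * P, ?_⟩
  rw [sub_comp, mul_comp, ← hP, C_comp, X_comp]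
  linear_combination -h0

section
variable {F N : Type*} [Field F] [Field N]

theorem coeff_comp_C_mul_X_add_C_natDegree_sub_one (P : N[X]) (a c : N) (m : ℕ)
    (hP : P.natDegree ≤ m + 1) :
    (P.comp (C a * X + C c)).coeff m =
      (P.coeff m + (m + 1) * P.coeff (m + 1) * c) * a ^ m := by
  have h1 : P.comp (C a * X + C c) = (taylor c P).comp (C a * X) := by
    rw [taylor_apply, comp_assoc]; simp
  rw [h1, comp_C_mul_X_coeff, taylor_coeff]
  congr 1
  have h2 : (hasseDeriv m P).natDegree < 2 := by
    have := natDegree_hasseDeriv_le P m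
    omega
  rw [eval_eq_sum_range' h2]
  simp only [Finset.sum_range_succ, Finset.sum_range_zero, hasseDeriv_coeff]
  simp [add_comm 1 m, Nat.choose_succ_self_right]

theorem leadingCoeff_comp_C_mul_X_add_C (P : N[X]) (a c : N) (ha : a ≠ 0) :
    (P.comp (C a * X + C c)).leadingCoeff = P.leadingCoeff * a ^ P.natDegree := by
  rw [leadingCoeff_comp (by rw [natDegree_linear ha]; simp), leadingCoeff_linear ha]

/-- Polynomials over `F` whose images under `i` and `s` agree up to the substitution
`X ↦ a X + c`. -/
noncomputable def semiInvariants (i s : F →+* N) (a c : N) : Subring F[X] :=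
  (mapRingHom i).eqLocus ((compRingHom (C a * X + C c)).comp (mapRingHom s))

theorem mem_semiInvariants {i s : F →+* N} {a c : N} {P : F[X]} :
    P ∈ semiInvariants i s a c ↔ P.map i = (P.map s).comp (C a * X + C c) := Iff.rfl

theorem map_leadingCoeff_of_mem_semiInvariants {i s : F →+* N} {a c : N} (ha : a ≠ 0) {P : F[X]}
    (hP : P ∈ semiInvariants i s a c) :
    i P.leadingCoeff = s P.leadingCoeff * a ^ P.natDegree := by
  have := congrArg leadingCoeff (mem_semiInvariants.1 hP)
  rwa [leadingCoeff_comp_C_mul_X_add_C _ _ _ ha, leadingCoeff_map, leadingCoeff_map,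
    natDegree_map] at this

theorem exists_natDegree_eq_of_mem_span_semiInvariants {i s : F →+* N} {a c : N} (ha : a ≠ 0)
    (n : ℕ) (h : F[X])
    (hh : h ∈ Submodule.span F {P | P ∈ semiInvariants i s a c ∧ P.degree < n}) (h0 : h ≠ 0) :
    ∃ P ∈ semiInvariants i s a c, P ≠ 0 ∧ P.natDegree = h.natDegree := by
  induction n generalizing h with
  | zero =>
    exfalso
    apply h0
    have : {P | P ∈ semiInvariants i s a c ∧ P.degree < (0 : ℕ)} ⊆ {0} := by
      rintro P ⟨-, hP⟩
      simpa [Nat.WithBot.lt_zero_iff] using hP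
    have := Submodule.span_mono this hh
    simpa using this
  | succ n ih =>
    have hlt : ∀ h' ∈ Submodule.span F {P | P ∈ semiInvariants i s a c ∧ P.degree < n},
        h'.degree < n := by
      intro h' hh'
      rw [← mem_degreeLT (R := F)]
      exact Submodule.span_le.2 (fun P hP => mem_degreeLT.2 hP.2) hh'
    by_cases hex : ∃ P ∈ semiInvariants i s a c, P.degree = n
    · obtain ⟨P₀, hP₀, hd⟩ := hex
      have hP₀0 : P₀ ≠ 0 := by rintro rfl; simp at hd
      have hnd : P₀.natDegree = n := natDegree_eq_of_degree_eq_some hd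
      have hl0 : P₀.leadingCoeff ≠ 0 := leadingCoeff_ne_zero.2 hP₀0
      have hle : Submodule.span F {P | P ∈ semiInvariants i s a c ∧ P.degree < (n + 1 : ℕ)} ≤
          Submodule.span F {P₀} ⊔
            Submodule.span F {P | P ∈ semiInvariants i s a c ∧ P.degree < n} := by
        rw [Submodule.span_le]
        rintro P ⟨hP, hPd⟩
        by_cases hPn : P.degree = n
        · have hPn' : P.natDegree = n := natDegree_eq_of_degree_eq_some hPn
          set r := P.leadingCoeff / P₀.leadingCoeff with hr
          have hir : i r = s r := by
            rw [hr, map_div₀, map_div₀, map_leadingCoeff_of_mem_semiInvariants ha hP,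
              map_leadingCoeff_of_mem_semiInvariants ha hP₀, hPn', hnd]
            exact mul_div_mul_right _ _ (pow_ne_zero _ ha)
          have hrV : C r ∈ semiInvariants i s a c := by
            rw [mem_semiInvariants]; simp [hir]
          rw [show P = r • P₀ + (P - C r * P₀) by rw [smul_eq_C_mul]; ring]
          refine Submodule.add_mem_sup (Submodule.smul_mem _ _ (Submodule.mem_span_singleton_self _))
            (Submodule.subset_span ⟨Subring.sub_mem _ hP (Subring.mul_mem _ hrV hP₀), ?_⟩)
          rw [← hPn]
          have hr0 : r ≠ 0 := by
            apply div_ne_zero _ hl0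
            rw [leadingCoeff_ne_zero]; rintro rfl; simp at hPn
          apply degree_sub_lt_left
          · rw [degree_C_mul hr0, hPn, hd]
          · rintro rfl; simp at hPn
          · rw [leadingCoeff_mul, leadingCoeff_C, hr, div_mul_cancel₀ _ hl0]
        · refine Submodule.mem_sup_right (Submodule.subset_span ⟨hP, ?_⟩)
          refine lt_of_le_of_ne ?_ hPn
          exact mem_degreeLE.1 (degreeLT_succ_eq_degreeLE (R := F) ▸ mem_degreeLT.2 hPd)
      obtain ⟨p, hp, h', hh', rfl⟩ := Submodule.mem_sup.1 (hle hh)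
      obtain ⟨x, rfl⟩ := Submodule.mem_span_singleton.1 hp
      by_cases hx : x = 0
      · subst hx
        rw [zero_smul, zero_add] at h0 ⊢
        exact ih _ hh' h0
      · refine ⟨P₀, hP₀, hP₀0, ?_⟩
        rw [smul_eq_C_mul]
        symm
        apply natDegree_eq_of_degree_eq
        rw [degree_add_eq_left_of_degree_lt, degree_C_mul hx]
        rw [degree_C_mul hx, hd]
        exact hlt _ hh'
    · refine ih h (Submodule.span_mono ?_ hh) h0
      rintro P ⟨hP, hPd⟩
      refine ⟨hP, lt_of_le_of_ne ?_ fun h => hex ⟨P, hP, h⟩⟩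
      exact mem_degreeLE.1 (degreeLT_succ_eq_degreeLE (R := F) ▸ mem_degreeLT.2 hPd)

theorem dvd_one_of_dvd_natDegree_semiInvariants {i s : F →+* N} {a c : N} (ha : a ≠ 0)
    {G : F[X]} (hG0 : G ≠ 0) (hG : G ∈ Submodule.span F (semiInvariants i s a c : Set F[X]))
    (hXG : X * G ∈ Submodule.span F (semiInvariants i s a c : Set F[X])) (g : ℕ)
    (hg : ∀ P ∈ semiInvariants i s a c, P ≠ 0 → g ∣ P.natDegree) : g ∣ 1 := by
  have key : ∀ h ∈ Submodule.span F (semiInvariants i s a c : Set F[X]), h ≠ 0 →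
      g ∣ h.natDegree := by
    intro h hh h0
    obtain ⟨n, hn⟩ : ∃ n : ℕ, h ∈
        Submodule.span F {P | P ∈ semiInvariants i s a c ∧ P.degree < n} := by
      clear h0
      induction hh using Submodule.span_induction with
      | mem x hx =>
        exact ⟨x.natDegree + 1, Submodule.subset_span ⟨hx,
          (degree_le_natDegree).trans_lt (by exact_mod_cast Nat.lt_succ_self _)⟩⟩
      | zero => exact ⟨0, Submodule.zero_mem _⟩
      | smul r x _ hx =>
        obtain ⟨n, hn⟩ := hx
        exact ⟨n, Submodule.smul_mem _ _ hn⟩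
      | add x y _ _ hx hy =>
        obtain ⟨n, hn⟩ := hx
        obtain ⟨m, hm⟩ := hy
        refine ⟨max n m, Submodule.add_mem _ (Submodule.span_mono ?_ hn)
          (Submodule.span_mono ?_ hm)⟩
        · rintro P ⟨hP, hd⟩
          exact ⟨hP, hd.trans_le (by exact_mod_cast le_max_left _ _)⟩
        · rintro P ⟨hP, hd⟩
          exact ⟨hP, hd.trans_le (by exact_mod_cast le_max_right _ _)⟩
    obtain ⟨P, hP, hP0, hd⟩ := exists_natDegree_eq_of_mem_span_semiInvariants ha n h hn h0
    rw [← hd]; exact hg P hP hP0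
  have h1 := key _ hG hG0
  have h2 := key _ hXG (mul_ne_zero X_ne_zero hG0)
  rw [natDegree_X_mul hG0] at h2
  exact (Nat.dvd_add_right h1).1 h2

theorem exists_linear_mem_semiInvariants {i s : F →+* N} {a c : N} (ha : a ≠ 0)
    {G : F[X]} (hG0 : G ≠ 0) (hG : G ∈ Submodule.span F (semiInvariants i s a c : Set F[X]))
    (hXG : X * G ∈ Submodule.span F (semiInvariants i s a c : Set F[X])) :
    ∃ q y : F, q ≠ 0 ∧ C q * X + C y ∈ semiInvariants i s a c := by
  obtain ⟨P, hP, hP0, hm⟩ : ∃ P ∈ semiInvariants i s a c, P ≠ 0 ∧ (P.natDegree : F) ≠ 0 := by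
    by_contra! hcon
    have := dvd_one_of_dvd_natDegree_semiInvariants ha hG0 hG hXG (ringChar F)
      (fun P hP h0 => (ringChar.spec F _).1 (hcon P hP h0))
    have h1 := (ringChar.spec F 1).2 this
    simp at h1
  obtain ⟨y, hy⟩ : ∃ y : F, i y * a = s y + c := by
    obtain ⟨m, hmm⟩ : ∃ m, P.natDegree = m + 1 := by
      apply Nat.exists_eq_succ_of_ne_zero
      intro h; simp [h] at hm
    have h1 := congrArg (fun p => p.coeff m) (mem_semiInvariants.1 hP)
    simp only [coeff_map] at h1
    rw [coeff_comp_C_mul_X_add_C_natDegree_sub_one _ _ _ _ (by rw [natDegree_map, hmm]),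
      coeff_map, coeff_map] at h1
    have h2 := map_leadingCoeff_of_mem_semiInvariants ha hP
    rw [leadingCoeff, hmm] at h2
    have hl : P.coeff (m + 1) ≠ 0 := by
      rw [← hmm]; exact leadingCoeff_ne_zero.2 hP0
    rw [hmm] at hm
    have hsl : s (P.coeff (m + 1)) ≠ 0 := (map_ne_zero s).2 hl
    have hmN : ((m : N) + 1) ≠ 0 := by
      have := (map_ne_zero s).2 hm
      simpa using this
    refine ⟨P.coeff m / ((m + 1) * P.coeff (m + 1)), ?_⟩
    simp only [map_div₀, map_mul, map_add, map_natCast, map_one, h1, h2]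
    field_simp
    ring
  obtain ⟨q, hq0, hq⟩ : ∃ q : F, q ≠ 0 ∧ i q = s q * a := by
    let H : AddSubgroup ℤ :=
      { carrier := {j | ∃ q : F, q ≠ 0 ∧ i q = s q * a ^ j}
        zero_mem' := ⟨1, one_ne_zero, by simp⟩
        add_mem' := by
          rintro j l ⟨q, hq0, hq⟩ ⟨r, hr0, hr⟩
          refine ⟨q * r, mul_ne_zero hq0 hr0, ?_⟩
          rw [map_mul, map_mul, hq, hr, zpow_add₀ ha]; ring
        neg_mem' := by
          rintro j ⟨q, hq0, hq⟩
          refine ⟨q⁻¹, inv_ne_zero hq0, ?_⟩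
          rw [map_inv₀, map_inv₀, hq, zpow_neg, mul_inv] }
    obtain ⟨g, hg⟩ := Int.subgroup_cyclic H
    rw [← AddSubgroup.zmultiples_eq_closure] at hg
    have h1 := dvd_one_of_dvd_natDegree_semiInvariants ha hG0 hG hXG g.natAbs (by
      intro P hP h0
      have : (P.natDegree : ℤ) ∈ H := ⟨P.leadingCoeff, leadingCoeff_ne_zero.2 h0, by
        rw [zpow_natCast]; exact map_leadingCoeff_of_mem_semiInvariants ha hP⟩
      rw [hg, Int.mem_zmultiples_iff] at this
      simpa using Int.natAbs_dvd_natAbs.2 this)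
    have h2 : (1 : ℤ) ∈ H := by
      rw [hg, Int.mem_zmultiples_iff]
      exact Int.natAbs_dvd_natAbs.1 (by simpa using h1)
    obtain ⟨q, hq0, hq⟩ := h2
    exact ⟨q, hq0, by simpa using hq⟩
  refine ⟨q, q * y, hq0, ?_⟩
  rw [mem_semiInvariants]
  simp only [Polynomial.map_add, Polynomial.map_mul, map_C, map_X, add_comp, mul_comp, C_comp,
    X_comp, map_mul, hq]
  have : C (i y) * C a = C (s y) + C c := by rw [← C_mul, hy, C_add]
  linear_combination C (s q) * this
end

section
variable {N M' : Type*} [Field N] [Field M'] [Algebra N M']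

theorem exists_linear_of_transcendental {u v : M'} (hu : Transcendental N u) {P Q : N[X]}
    (hPQ : aeval v P = aeval u Q) (hdeg : P.natDegree = Q.natDegree) (hpos : 0 < P.natDegree)
    (hv : v ∈ (IsFractionRing.lift (K := RatFunc N) (g := (aeval u : N[X] →ₐ[N] M').toRingHom)
      (transcendental_iff_injective.1 hu)).fieldRange) :
    ∃ a c : N, a ≠ 0 ∧ v = aeval u (C a * X + C c) := by
  set j := IsFractionRing.lift (K := RatFunc N) (g := (aeval u : N[X] →ₐ[N] M').toRingHom)
      (transcendental_iff_injective.1 hu) with hj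
  have hjalg : ∀ p : N[X], j (algebraMap N[X] (RatFunc N) p) = aeval u p := fun p =>
    IsFractionRing.lift_algebraMap _ p
  obtain ⟨r, rfl⟩ := hv
  have hcomp : j.comp ((algebraMap N[X] (RatFunc N)).comp C) = algebraMap N M' := by
    ext a
    exact (hjalg (C a)).trans (aeval_C u a)
  have hr : aeval r (P.map C) = algebraMap N[X] (RatFunc N) Q := by
    apply j.injective
    rw [hjalg, ← hPQ, aeval_def, eval₂_map, hom_eval₂, hcomp]
    rfl
  have hP0 : P ≠ 0 := by rintro rfl; simp at hpos
  have hint : IsIntegral N[X] r := by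
    refine IsIntegral.of_aeval_monic (p := (C P.leadingCoeff⁻¹ * P).map C) ?_ ?_ ?_
    · apply Monic.map
      rw [mul_comm]; exact monic_mul_leadingCoeff_inv hP0
    · rw [natDegree_map_eq_of_injective C_injective,
        natDegree_C_mul (inv_ne_zero (leadingCoeff_ne_zero.2 hP0))]
      exact hpos.ne'
    · rw [Polynomial.map_mul, map_mul, hr, map_C, aeval_C, ← map_mul]
      exact isIntegral_algebraMap
  obtain ⟨W, rfl⟩ := IsIntegrallyClosed.isIntegral_iff.1 hint
  rw [hjalg] at hPQ ⊢
  have hW : P.comp W = Q := by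
    apply transcendental_iff_injective.1 hu
    rw [← hPQ, aeval_comp]
  have hWd : W.natDegree = 1 := by
    have := congrArg natDegree hW
    rw [natDegree_comp, ← hdeg] at this
    exact Nat.eq_of_mul_eq_mul_left hpos (by rw [this, mul_one])
  obtain ⟨a, ha, c, rfl⟩ := natDegree_eq_one.1 hWd
  exact ⟨a, c, ha, rfl⟩
end

theorem comp_left_injective_of_natDegree_pos {F : Type*} [Field F] {z : F[X]} (hz : 0 < z.natDegree)
    {p q : F[X]} (h : p.comp z = q.comp z) : p = q := by
  rw [← sub_eq_zero, ← sub_comp, comp_eq_zero_iff] at h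
  rcases h with h | ⟨-, h⟩
  · exact sub_eq_zero.1 h
  · rw [h, natDegree_C] at hz; omega

theorem mul_mem_span_subring {F R : Type*} [Field F] [CommRing R] [Algebra F R] (V : Subring R)
    {x y : R} (hx : x ∈ Submodule.span F (V : Set R)) (hy : y ∈ Submodule.span F (V : Set R)) :
    x * y ∈ Submodule.span F (V : Set R) := by
  have := Submodule.mul_mem_mul hx hy
  rw [Submodule.span_mul_span] at this
  refine Submodule.span_mono ?_ this
  rintro _ ⟨a, ha, b, hb, rfl⟩
  exact V.mul_mem ha hb

theorem exists_generator_of_eqLocus {F M M' : Type*} [Field F] [Field M] [Field M']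
    [Algebra F[X] M] [IsFractionRing F[X] M] (ι σ : M →+* M') (N : Subfield M')
    (hι : ∀ a : F, ι (algebraMap F[X] M (C a)) ∈ N)
    (hσ : ∀ a : F, σ (algebraMap F[X] M (C a)) ∈ N)
    (hT : ∀ f : F[X], 0 < f.natDegree → ι (algebraMap F[X] M f) = σ (algebraMap F[X] M f) →
      Transcendental N (ι (algebraMap F[X] M f)))
    (f₀ : F[X]) (hf₀ : 0 < f₀.natDegree)
    (hf₀e : ι (algebraMap F[X] M f₀) = σ (algebraMap F[X] M f₀)) :
    ∃ ζ : F[X], 0 < ζ.natDegree ∧ ι (algebraMap F[X] M ζ) = σ (algebraMap F[X] M ζ) ∧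
      ∀ f : F[X], ι (algebraMap F[X] M f) = σ (algebraMap F[X] M f) →
        ∃ P : F[X], (∀ j, ι (algebraMap F[X] M (C (P.coeff j))) =
          σ (algebraMap F[X] M (C (P.coeff j)))) ∧ f = P.comp ζ := by
  set al := algebraMap F[X] M with hal
  have hinj : Function.Injective al := IsFractionRing.injective F[X] M
  let A : Subring F[X] := (ι.comp al).eqLocus (σ.comp al)
  have hA : ∀ f, f ∈ A ↔ ι (al f) = σ (al f) := fun f => Iff.rfl
  let L : Subfield M := Subfield.closure (Set.range (fun a : F => al (C a)) ∪ al '' A)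
  have hLF : ∀ a : F, al (C a) ∈ L := fun a => Subfield.subset_closure (Or.inl ⟨a, rfl⟩)
  have hLA : ∀ f ∈ A, al f ∈ L := fun f hf => Subfield.subset_closure (Or.inr ⟨f, hf, rfl⟩)
  obtain ⟨z, hz, hzL, hzA⟩ := exists_forall_eq_comp_of_mem_subfield L hLF f₀
    (hLA f₀ hf₀e) hf₀
  let iN : F →+* N := (ι.comp (al.comp C)).codRestrict N hι
  let sN : F →+* N := (σ.comp (al.comp C)).codRestrict N hσ
  have hcι : ∀ P w : F[X], ι (al (P.comp w)) = aeval (ι (al w)) (P.map iN) := by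
    intro P w
    rw [comp, hom_eval₂, hom_eval₂, aeval_def, eval₂_map]; rfl
  have hcσ : ∀ P w : F[X], σ (al (P.comp w)) = aeval (σ (al w)) (P.map sN) := by
    intro P w
    rw [comp, hom_eval₂, hom_eval₂, aeval_def, eval₂_map]; rfl
  have hu : Transcendental N (ι (al z)) := by
    obtain ⟨P, hP⟩ := hzA f₀ (hLA f₀ hf₀e)
    have := hT f₀ hf₀ hf₀e
    rw [hP, hcι] at this
    intro h
    exact this (isAlgebraic_iff_isIntegral.2 (IsIntegral.of_mem_of_fg _
      (isAlgebraic_iff_isIntegral.1 h).fg_adjoin_singleton _ (aeval_mem_adjoin_singleton _ _)))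
  have huinj := transcendental_iff_injective.1 hu
  obtain ⟨a, c, ha, hv⟩ : ∃ a c : N, a ≠ 0 ∧ σ (al z) = aeval (ι (al z)) (C a * X + C c) := by
    obtain ⟨P, hP⟩ := hzA f₀ (hLA f₀ hf₀e)
    refine exists_linear_of_transcendental hu (P := P.map sN) (Q := P.map iN) ?_ ?_ ?_ ?_
    · rw [← hcσ, ← hcι, ← hP, hf₀e]
    · rw [natDegree_map, natDegree_map]
    · rw [natDegree_map]
      rw [hP, natDegree_comp] at hf₀
      exact Nat.pos_of_mul_pos_right hf₀
    · set j := IsFractionRing.lift (K := RatFunc N)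
        (g := (aeval (ι (al z)) : N[X] →ₐ[N] M').toRingHom) huinj
      have hjalg : ∀ p : N[X], j (algebraMap N[X] (RatFunc N) p) = aeval (ι (al z)) p := fun p =>
        IsFractionRing.lift_algebraMap _ p
      have : L ≤ j.fieldRange.comap σ := by
        rw [Subfield.closure_le]
        rintro _ (⟨b, rfl⟩ | ⟨f, hf, rfl⟩)
        · exact ⟨algebraMap N[X] (RatFunc N) (C (sN b)), by rw [hjalg, aeval_C]; rfl⟩
        · obtain ⟨P, hP⟩ := hzA f (hLA f hf)
          refine ⟨algebraMap N[X] (RatFunc N) (P.map iN), ?_⟩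
          rw [hjalg, ← hcι, ← hP]
          exact hf
      exact this hzL
  have hV : ∀ P : F[X], P.comp z ∈ A ↔ P ∈ semiInvariants iN sN a c := by
    intro P
    rw [hA, hcι, hcσ, hv, ← aeval_comp, huinj.eq_iff, mem_semiInvariants]
  set V := semiInvariants iN sN a c with hVdef
  -- every element of the subring generated by `F` and `A` is in the span of `V`
  have hspan : ∀ m ∈ Subring.closure (Set.range (fun a : F => al (C a)) ∪ al '' A),
      ∃ h ∈ Submodule.span F (V : Set F[X]), m = al (h.comp z) := by
    intro m hm
    have h1V : (1 : F[X]) ∈ Submodule.span F (V : Set F[X]) := Submodule.subset_span V.one_mem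
    induction hm using Subring.closure_induction with
    | mem x hx =>
      rcases hx with ⟨b, rfl⟩ | ⟨f, hf, rfl⟩
      · refine ⟨C b, ?_, by simp⟩
        have := Submodule.smul_mem _ b h1V
        rwa [smul_eq_C_mul, mul_one] at this
      · obtain ⟨P, hP⟩ := hzA f (hLA f hf)
        exact ⟨P, Submodule.subset_span ((hV P).1 (hP ▸ hf)), by rw [← hP]⟩
    | zero => exact ⟨0, Submodule.zero_mem _, by simp⟩
    | one => exact ⟨1, h1V, by simp⟩
    | add x y _ _ hx hy =>
      obtain ⟨p, hp, rfl⟩ := hx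
      obtain ⟨q, hq, rfl⟩ := hy
      exact ⟨p + q, Submodule.add_mem _ hp hq, by rw [add_comp, map_add]⟩
    | neg x _ hx =>
      obtain ⟨p, hp, rfl⟩ := hx
      exact ⟨-p, Submodule.neg_mem _ hp, by rw [neg_comp, map_neg]⟩
    | mul x y _ _ hx hy =>
      obtain ⟨p, hp, rfl⟩ := hx
      obtain ⟨q, hq, rfl⟩ := hy
      exact ⟨p * q, mul_mem_span_subring V hp hq, by rw [mul_comp, map_mul]⟩
  obtain ⟨q, y, hq0, hqy⟩ : ∃ q y : F, q ≠ 0 ∧ C q * X + C y ∈ V := by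
    obtain ⟨m₁, hm₁, m₂, hm₂, hm⟩ := Subfield.mem_closure_iff.1 hzL
    obtain ⟨H, hH, rfl⟩ := hspan _ hm₁
    obtain ⟨G, hG, rfl⟩ := hspan _ hm₂
    have hz0 : al z ≠ 0 := by
      rw [map_ne_zero_iff _ hinj]; rintro rfl; simp at hz
    have hGz : al (G.comp z) ≠ 0 := by
      intro h; rw [h, div_zero] at hm; exact hz0 hm.symm
    have hXG : X * G = H := by
      apply comp_left_injective_of_natDegree_pos hz
      apply hinj
      rw [mul_comp, X_comp, map_mul, ← hm, div_mul_cancel₀ _ hGz]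
    refine exists_linear_mem_semiInvariants ha (G := G) ?_ hG (hXG ▸ hH)
    rintro rfl; simp at hGz
  have hζdeg : 0 < ((C q * X + C y).comp z).natDegree := by
    rw [natDegree_comp, natDegree_linear hq0, one_mul]; exact hz
  have hζA := (hV _).2 hqy
  refine ⟨(C q * X + C y).comp z, hζdeg, (hA _).1 hζA, ?_⟩
  intro f hf
  obtain ⟨P, hP⟩ := hzA f (hLA f hf)
  set ζ := (C q * X + C y).comp z with hζ
  set P' := P.comp (C q⁻¹ * X - C (q⁻¹ * y)) with hP'
  have hf' : f = P'.comp ζ := by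
    rw [hP, hP', comp_assoc]
    congr 1
    simp only [hζ, sub_comp, mul_comp, C_comp, X_comp, add_comp]
    have : C q⁻¹ * C q = 1 := by rw [← C_mul, inv_mul_cancel₀ hq0, C_1]
    rw [C_mul]
    linear_combination (-z) * this
  refine ⟨P', ?_, hf'⟩
  have hζT := hT ζ hζdeg hζA
  rw [hf', hcι, hcσ, ← (hA ζ).1 hζA] at hf
  have := transcendental_iff_injective.1 hζT hf
  intro j
  have h2 := congrArg (fun p => (p.coeff j : M')) this
  simp only [coeff_map] at h2
  exact h2

theorem mem_algebraicClosure_of_isAlgebraic_subfield {k E : Type*} [Field k] [Field E] [Algebra k E]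
    (N : Subfield E) (hN : ∀ x ∈ N, x ∈ algebraicClosure k E) {w : E} (hw : IsAlgebraic N w) :
    w ∈ algebraicClosure k E := by
  have h1 : IsAlgebraic (algebraicClosure k E) w :=
    hw.ringHom_of_comp_eq (N.subtype.codRestrict (algebraicClosure k E) fun x => hN x x.2)
      (RingHom.id E) (RingHom.injective _) rfl
  exact mem_algebraicClosure_iff.2 (h1.restrictScalars k)

theorem isAlgebraic_eval₂_root {F E : Type*} [Field F] [Field E] (E' : Subfield E) (i : F →+* E)
    (hi : ∀ a, i a ∈ E') {t : E} {f : F[X]} (hf : 0 < f.natDegree) (hw : eval₂ i t f ∈ E') :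
    IsAlgebraic E' t := by
  refine ⟨f.map (i.codRestrict E' hi) - C ⟨_, hw⟩, ?_, ?_⟩
  · intro h
    have h1 : (f.map (i.codRestrict E' hi)).natDegree = 0 := by
      rw [sub_eq_zero.1 h, natDegree_C]
    rw [natDegree_map] at h1
    omega
  · rw [map_sub, aeval_C, aeval_def, eval₂_map]
    exact sub_self _

theorem transcendental_of_lt_trdeg {K F E : Type u} [Field K] [Field F] [Field E] [Algebra K F]
    [Algebra K E] (i s : F →ₐ[K] E) (hF : Algebra.trdeg K F + Algebra.trdeg K F < Algebra.trdeg K E)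
    (N : Subfield E) (hN : N = Subfield.closure (Set.range i ∪ Set.range s)) (ti ts : E)
    (hgen : ∀ E' : Subfield E, (∀ a, i a ∈ E') → (∀ a, s a ∈ E') → ti ∈ E' → ts ∈ E' → E' = ⊤)
    (f : F[X]) (hf : 0 < f.natDegree) (w : E) (hi : eval₂ (i : F →+* E) ti f = w)
    (hs : eval₂ (s : F →+* E) ts f = w) : Transcendental N w := by
  intro hw
  obtain ⟨S, hS⟩ := exists_isTranscendenceBasis K F
  set T : Set E := i '' S ∪ s '' S with hT
  set k := IntermediateField.adjoin K T with hk
  have hSalg := hS.isAlgebraic_field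
  rw [Subtype.range_coe] at hSalg
  have key : ∀ j : F →ₐ[K] E, j '' S ⊆ T → ∀ a, j a ∈ algebraicClosure k E := by
    intro j hj a
    rw [mem_algebraicClosure_iff]
    have hle : ∀ x : IntermediateField.adjoin K S, j x ∈ k := by
      intro x
      have : IntermediateField.adjoin K S ≤ k.comap j := by
        rw [IntermediateField.adjoin_le_iff]
        intro y hy
        exact IntermediateField.subset_adjoin K T (hj ⟨y, hy, rfl⟩)
      exact this x.2
    exact (hSalg.isAlgebraic a).ringHom_of_comp_eq
      (((j : F →+* E).comp (algebraMap (IntermediateField.adjoin K S) F)).codRestrict k hle)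
      (j : F →+* E) (RingHom.injective _) rfl
  have hiE := key i Set.subset_union_left
  have hsE := key s Set.subset_union_right
  have hNE : ∀ x ∈ N, x ∈ algebraicClosure k E := by
    intro x hx
    have : N ≤ (algebraicClosure k E).toSubfield := by
      rw [hN, Subfield.closure_le]
      rintro _ (⟨a, rfl⟩ | ⟨a, rfl⟩)
      · exact hiE a
      · exact hsE a
    exact this hx
  have hwE := mem_algebraicClosure_of_isAlgebraic_subfield N hNE hw
  have htop : (algebraicClosure k E).toSubfield = ⊤ := by
    refine hgen _ hiE hsE ?_ ?_
    · exact mem_algebraicClosure_of_isAlgebraic_subfield (algebraicClosure k E).toSubfield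
        (fun x hx => hx) (isAlgebraic_eval₂_root _ (i : F →+* E) hiE hf (by rw [hi]; exact hwE))
    · exact mem_algebraicClosure_of_isAlgebraic_subfield (algebraicClosure k E).toSubfield
        (fun x hx => hx) (isAlgebraic_eval₂_root _ (s : F →+* E) hsE hf (by rw [hs]; exact hwE))
  have halg : Algebra.IsAlgebraic k E := ⟨fun x => by
    rw [← mem_algebraicClosure_iff]
    have : x ∈ (algebraicClosure k E).toSubfield := htop ▸ Subfield.mem_top x
    exact this⟩
  open IntermediateField.algebraAdjoinAdjoin in
  have halg' : Algebra.IsAlgebraic (Algebra.adjoin K T) E :=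
    (IsFractionRing.comap_isAlgebraic_iff (A := Algebra.adjoin K T) (K := k)).2 halg
  have h1 := Algebra.IsAlgebraic.trdeg_le_cardinalMk K T (A := E)
  have h2 : Cardinal.mk T ≤ Algebra.trdeg K F + Algebra.trdeg K F := by
    rw [← hS.cardinalMk_eq_trdeg]
    exact (Cardinal.mk_union_le _ _).trans (add_le_add Cardinal.mk_image_le Cardinal.mk_image_le)
  exact absurd hF (not_lt.2 (h1.trans h2))

theorem exists_eval₂_of_coeff_mem {F : Type*} [Field F] (k : Subfield F) (P : F[X])
    (hP : ∀ j, P.coeff j ∈ k) : ∃ P' : k[X], P'.map k.subtype = P := by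
  rw [← mem_lifts, lifts_iff_coeff_lifts]
  exact fun j => ⟨⟨_, hP j⟩, rfl⟩

theorem forall_mem_range_of_isIntegral {D F τ : Type*} [CommRing D] [IsDomain D] [Field F]
    (ψ : MvPolynomial τ D →+* F[X]) (hψ : Function.Injective ψ)
    (hloc : ∀ p : F[X], ∃ r r' : MvPolynomial τ D, ∃ b : F, b ≠ 0 ∧ ψ r = C b ∧ C b * p = ψ r')
    (k : Subfield F) (A : Subring F[X]) (hAD : ∀ d, ψ (MvPolynomial.C d) ∈ A)
    (hfrac : ∀ f ∈ A, ∃ a b : D, b ≠ 0 ∧ f * ψ (MvPolynomial.C b) = ψ (MvPolynomial.C a))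
    (hk : ∀ a, C a ∈ A ↔ a ∈ k) (hint : ∀ f ∈ A, (ψ.comp MvPolynomial.C).IsIntegralElem f)
    (ζ : F[X]) (hζA : ζ ∈ A)
    (hζ : ∀ f ∈ A, ∃ P : F[X], (∀ j, P.coeff j ∈ k) ∧ f = P.comp ζ) :
    ∀ f ∈ A, ∃ d, ψ (MvPolynomial.C d) = f := by
  intro z hz
  by_contra hcon
  let c : D →+* A := (ψ.comp MvPolynomial.C).codRestrict A hAD
  algebraize [c]
  have hcinj : Function.Injective (algebraMap D A) := fun x y h =>
    MvPolynomial.C_injective τ D (hψ (congrArg Subtype.val h))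
  have hcint : Algebra.IsIntegral D A := ⟨fun x => by
    obtain ⟨p, hp, h⟩ := hint x x.2
    refine ⟨p, hp, Subtype.ext ?_⟩
    have := hom_eval₂ p (algebraMap D A) A.subtype x
    rw [Subring.subtype_apply] at this
    rw [this]
    exact h⟩
  have hPIR : IsPrincipalIdealRing A := by
    let i : k →+* A := ((C : F →+* F[X]).comp k.subtype).codRestrict A fun a => (hk _).2 a.2
    refine IsPrincipalIdealRing.of_surjective (eval₂RingHom i ⟨ζ, hζA⟩) ?_
    intro x
    obtain ⟨P, hP, hx⟩ := hζ x x.2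
    obtain ⟨P', rfl⟩ := exists_eval₂_of_coeff_mem k P hP
    refine ⟨P', Subtype.ext ?_⟩
    rw [hx, comp, eval₂_map]
    exact hom_eval₂ P' i A.subtype _
  let I : Ideal D :=
    { carrier := {a | ∃ d, ψ (MvPolynomial.C a) * z = ψ (MvPolynomial.C d)}
      zero_mem' := ⟨0, by simp⟩
      add_mem' := by
        rintro a b ⟨d, hd⟩ ⟨e, he⟩
        exact ⟨d + e, by simp only [map_add, add_mul, hd, he]⟩
      smul_mem' := by
        rintro r a ⟨d, hd⟩
        refine ⟨r * d, by simp only [smul_eq_mul, map_mul, mul_assoc, hd]⟩ }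
  have hI : I ≠ ⊤ := by
    rw [Ne, Ideal.eq_top_iff_one]
    rintro ⟨d, hd⟩
    exact hcon ⟨d, by simpa using hd.symm⟩
  have hIA : I.map (algebraMap D A) ≠ ⊤ := by
    rw [Ne, Ideal.map_eq_top_iff _ hcinj (algebraMap_isIntegral_iff.2 hcint)]
    exact hI
  obtain ⟨h, hh⟩ := (hPIR.principal (I.map (algebraMap D A))).principal
  rw [Ideal.submodule_span_eq] at hh
  have hdvd : ∀ a ∈ I, (h : F[X]) ∣ ψ (MvPolynomial.C a) := by
    intro a ha
    have h1 : algebraMap D A a ∈ Ideal.span {h} := hh ▸ Ideal.mem_map_of_mem _ ha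
    obtain ⟨q, hq⟩ := Ideal.mem_span_singleton.1 h1
    exact ⟨q, congrArg Subtype.val hq⟩
  obtain ⟨r, r', b, hb, hr, hr'⟩ := hloc z
  obtain ⟨a₁, a₂, ha₂, ha⟩ := hfrac z hz
  have hmul : r * MvPolynomial.C a₁ = r' * MvPolynomial.C a₂ := by
    apply hψ
    rw [map_mul, map_mul, ← ha, ← hr', ← hr]
    ring
  have hcoef : ∀ γ, r.coeff γ ∈ I := by
    intro γ
    have h1 := congrArg (MvPolynomial.coeff γ) hmul
    rw [mul_comm r, mul_comm r', MvPolynomial.coeff_C_mul, MvPolynomial.coeff_C_mul, mul_comm a₁,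
      mul_comm a₂] at h1
    refine ⟨r'.coeff γ, ?_⟩
    have hne : ψ (MvPolynomial.C a₂) ≠ 0 := by
      rw [Ne, map_eq_zero_iff _ hψ, MvPolynomial.C_eq_zero]; exact ha₂
    apply mul_right_cancel₀ hne
    rw [mul_assoc, ha, ← map_mul, ← map_mul, ← map_mul, ← map_mul, h1]
  have hhb : (h : F[X]) ∣ C b := by
    rw [← hr, r.as_sum, map_sum]
    refine Finset.dvd_sum fun γ _ => ?_
    rw [MvPolynomial.monomial_eq, map_mul]
    exact Dvd.dvd.mul_right (hdvd _ (hcoef γ)) _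
  have hu : IsUnit (h : F[X]) := isUnit_of_dvd_unit hhb (isUnit_C.2 hb.isUnit)
  obtain ⟨c₀, hc₀, hc⟩ := Polynomial.isUnit_iff.1 hu
  have hck : c₀ ∈ k := (hk c₀).1 (by rw [hc]; exact h.2)
  have hcinv : C c₀⁻¹ ∈ A := (hk _).2 (k.inv_mem hck)
  apply hIA
  rw [hh, Ideal.span_singleton_eq_top]
  refine IsUnit.of_mul_eq_one ⟨_, hcinv⟩ (Subtype.ext ?_)
  change (h : F[X]) * C c₀⁻¹ = 1
  rw [← hc, ← C_mul, mul_inv_cancel₀ hc₀.ne_zero, C_1]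

section
variable {D τ : Type*} [CommRing D]

theorem MvPolynomial.coeff_map_C (p : MvPolynomial τ D) (γ : τ →₀ ℕ) :
    (MvPolynomial.map (MvPolynomial.C : D →+* MvPolynomial τ D) p).coeff γ =
      MvPolynomial.C (p.coeff γ) := MvPolynomial.coeff_map _ _ _

theorem MvPolynomial.exists_C_mul_eq_of_swap [IsDomain D] {p q : MvPolynomial τ D} (hq : q ≠ 0)
    (h : MvPolynomial.C p * MvPolynomial.map MvPolynomial.C q =
      MvPolynomial.map (MvPolynomial.C : D →+* MvPolynomial τ D) p * MvPolynomial.C q) :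
    ∃ a b : D, b ≠ 0 ∧ p * MvPolynomial.C b = MvPolynomial.C a * q := by
  obtain ⟨γ, hγ⟩ := MvPolynomial.ne_zero_iff.1 hq
  refine ⟨p.coeff γ, q.coeff γ, hγ, ?_⟩
  have h1 := congrArg (MvPolynomial.coeff γ) h
  rw [MvPolynomial.coeff_C_mul, mul_comm, mul_comm _ (MvPolynomial.C q), MvPolynomial.coeff_C_mul,
    MvPolynomial.coeff_map_C, MvPolynomial.coeff_map_C] at h1
  rw [mul_comm, h1, mul_comm]

variable (D τ) [IsDomain D] (M : Type*) [Field M] [Algebra (MvPolynomial τ D) M]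
  [IsFractionRing (MvPolynomial τ D) M]

/-- The first of the two embeddings of `Frac D[τ]` into `Frac D[τ][τ]`. -/
noncomputable def inclLeft : M →+* FractionRing (MvPolynomial τ (MvPolynomial τ D)) :=
  IsFractionRing.lift (A := MvPolynomial τ D)
    (g := (algebraMap (MvPolynomial τ (MvPolynomial τ D)) _).comp MvPolynomial.C)
    ((IsFractionRing.injective (MvPolynomial τ (MvPolynomial τ D)) (FractionRing _)).comp
      (MvPolynomial.C_injective _ _))

/-- The second of the two embeddings of `Frac D[τ]` into `Frac D[τ][τ]`. -/
noncomputable def inclRight : M →+* FractionRing (MvPolynomial τ (MvPolynomial τ D)) :=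
  IsFractionRing.lift (A := MvPolynomial τ D)
    (g := (algebraMap (MvPolynomial τ (MvPolynomial τ D)) _).comp
      (MvPolynomial.map (MvPolynomial.C : D →+* MvPolynomial τ D)))
    ((IsFractionRing.injective (MvPolynomial τ (MvPolynomial τ D)) (FractionRing _)).comp
      (MvPolynomial.map_injective _ (MvPolynomial.C_injective _ _)))

theorem inclLeft_algebraMap (p : MvPolynomial τ D) :
    inclLeft D τ M (algebraMap _ M p) =
      algebraMap (MvPolynomial τ (MvPolynomial τ D)) _ (MvPolynomial.C p) :=
  IsFractionRing.lift_algebraMap _ p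

theorem inclRight_algebraMap (p : MvPolynomial τ D) :
    inclRight D τ M (algebraMap _ M p) = algebraMap (MvPolynomial τ (MvPolynomial τ D)) _
      (MvPolynomial.map (MvPolynomial.C : D →+* MvPolynomial τ D) p) :=
  IsFractionRing.lift_algebraMap _ p

theorem inclLeft_eq_inclRight_C (d : D) :
    inclLeft D τ M (algebraMap (MvPolynomial τ D) M (MvPolynomial.C d)) =
      inclRight D τ M (algebraMap (MvPolynomial τ D) M (MvPolynomial.C d)) := by
  rw [inclLeft_algebraMap, inclRight_algebraMap, MvPolynomial.map_C]

theorem exists_mul_eq_of_inclLeft_eq_inclRight {m : M} (hm : inclLeft D τ M m =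
    inclRight D τ M m) :
    ∃ a b : D, b ≠ 0 ∧ m * algebraMap (MvPolynomial τ D) M (MvPolynomial.C b) =
      algebraMap (MvPolynomial τ D) M (MvPolynomial.C a) := by
  obtain ⟨p, q, hq, rfl⟩ := IsFractionRing.div_surjective (A := MvPolynomial τ D) m
  have hq0 : q ≠ 0 := nonZeroDivisors.ne_zero hq
  have hqM : algebraMap (MvPolynomial τ D) M q ≠ 0 := by
    rw [Ne, map_eq_zero_iff _ (IsFractionRing.injective _ M)]; exact hq0
  have h1 := (map_ne_zero (inclLeft D τ M)).2 hqM
  have h2 := (map_ne_zero (inclRight D τ M)).2 hqM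
  rw [map_div₀, map_div₀, div_eq_div_iff h1 h2, inclLeft_algebraMap, inclLeft_algebraMap,
    inclRight_algebraMap, inclRight_algebraMap, ← map_mul, ← map_mul] at hm
  obtain ⟨a, b, hb, h⟩ := MvPolynomial.exists_C_mul_eq_of_swap hq0 (IsFractionRing.injective _ _ hm)
  refine ⟨a, b, hb, ?_⟩
  rw [div_mul_eq_mul_div, div_eq_iff hqM, ← map_mul, ← map_mul, h]
end

theorem subfield_eq_top_of_incl_mem {D τ : Type*} [CommRing D] [IsDomain D] (M : Type*) [Field M]
    [Algebra (MvPolynomial τ D) M] [IsFractionRing (MvPolynomial τ D) M]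
    (E : Subfield (FractionRing (MvPolynomial τ (MvPolynomial τ D))))
    (h1 : ∀ p : MvPolynomial τ D, inclLeft D τ M (algebraMap _ M p) ∈ E)
    (h2 : ∀ p : MvPolynomial τ D, inclRight D τ M (algebraMap _ M p) ∈ E) : E = ⊤ := by
  have key : ∀ P : MvPolynomial τ (MvPolynomial τ D), algebraMap _ (FractionRing _) P ∈ E := by
    intro P
    induction P using MvPolynomial.induction_on with
    | C a => rw [← inclLeft_algebraMap D τ M]; exact h1 a
    | add p q hp hq => rw [map_add]; exact E.add_mem hp hq
    | mul_X p i hp =>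
      rw [map_mul]
      refine E.mul_mem hp ?_
      have := h2 (MvPolynomial.X i)
      rwa [inclRight_algebraMap, MvPolynomial.map_X] at this
  rw [eq_top_iff]
  intro x _
  obtain ⟨p, q, -, rfl⟩ :=
    IsFractionRing.div_surjective (A := MvPolynomial τ (MvPolynomial τ D)) x
  exact E.div_mem (key p) (key q)

section trdeg
open Cardinal

theorem trdeg_fractionRing (K D : Type u) [Field K] [CommRing D] [IsDomain D] [Algebra K D] :
    Algebra.trdeg K (FractionRing D) = Algebra.trdeg K D := by
  have : Algebra.IsAlgebraic D (FractionRing D) := IsLocalization.isAlgebraic _ (nonZeroDivisors D)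
  rw [← trdeg_add_eq K D, _root_.trdeg_eq_zero (R := D) (A := FractionRing D), add_zero]

theorem trdeg_mvPolynomial (K D τ : Type u) [Field K] [CommRing D] [IsDomain D] [Algebra K D] :
    Algebra.trdeg K (MvPolynomial τ D) = Algebra.trdeg K D + #τ := by
  rw [← trdeg_add_eq K D, MvPolynomial.trdeg_of_isDomain, Cardinal.lift_id]

theorem trdeg_polynomial (K D : Type u) [Field K] [CommRing D] [IsDomain D] [Algebra K D] :
    Algebra.trdeg K D[X] = Algebra.trdeg K D + 1 := by
  rw [← trdeg_add_eq K D, Polynomial.trdeg_of_isDomain]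
end trdeg

theorem isAlgebraic_of_C_mul_eq {K D : Type u} {F : Type*} [Field K] [CommRing D] [IsDomain D]
    [Field F] [Algebra K D] [Algebra K F] (j : D →ₐ[K] F[X]) (hj : Function.Injective j)
    (htr : Algebra.trdeg K D = 1) (d : D) (hd : 0 < (j d).natDegree) (q : F) (a b : D)
    (hb : b ≠ 0) (hq : C q * j b = j a) : IsAlgebraic K q := by
  by_contra hna
  let M := FractionRing F[X]
  have hM : Function.Injective (algebraMap F[X] M) := IsFractionRing.injective _ _
  have hM' : Function.Injective (algebraMap F M) := (algebraMap F M).injective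
  let g₀ : D →ₐ[K] M := (IsScalarTower.toAlgHom K F[X] M).comp j
  have hg₀ : Function.Injective g₀ := hM.comp hj
  let g : FractionRing D →ₐ[K] M := IsFractionRing.liftAlgHom (g := g₀) hg₀
  have hg : ∀ x, g (algebraMap D _ x) = algebraMap F[X] M (j x) := fun x =>
    IsFractionRing.lift_algebraMap (A := D) hg₀ x
  have hb' : algebraMap F[X] M (j b) ≠ 0 := by
    rw [Ne, map_eq_zero_iff _ hM, map_eq_zero_iff _ hj]; exact hb
  let q₀ : FractionRing D := algebraMap D _ a / algebraMap D _ b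
  have hq₀ : g q₀ = algebraMap F M q := by
    rw [map_div₀, hg, hg, div_eq_iff hb', ← hq, map_mul, IsScalarTower.algebraMap_apply F F[X] M]
    rfl
  have ht : Transcendental K q₀ := by
    intro h
    have := h.algHom g
    rw [hq₀] at this
    exact hna ((isAlgebraic_algebraMap_iff hM').1 this)
  have hind : AlgebraicIndependent K (fun _ : PUnit.{u+1} => q₀) :=
    algebraicIndependent_unique_type_iff.2 ht
  have hbas := hind.isTranscendenceBasis_of_trdeg_le_of_finite (by
    rw [trdeg_fractionRing, htr, Cardinal.mk_punit])
  have halg := hbas.isAlgebraic.isAlgebraic (algebraMap D (FractionRing D) d)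
  set S := Algebra.adjoin K (Set.range fun _ : PUnit.{u+1} => q₀) with hS
  have hle : S ≤ (IsScalarTower.toAlgHom K F M).range.comap g := by
    rw [hS]
    refine Algebra.adjoin_le ?_
    rintro _ ⟨_, rfl⟩
    exact ⟨q, hq₀.symm⟩
  have hle' : ∀ x, x ∈ S → ∃ y, algebraMap F M y = g x := fun x hx => hle hx
  choose! r hr' using hle'
  let f : S →+* F :=
    { toFun := fun x => r x
      map_one' := hM' (by rw [hr' _ (1 : S).2]; simp)
      map_zero' := hM' (by rw [hr' _ (0 : S).2]; simp)
      map_mul' := fun x y => hM' (by rw [hr' _ (x * y).2, map_mul, hr' _ x.2, hr' _ y.2]; simp)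
      map_add' := fun x y => hM' (by rw [hr' _ (x + y).2, map_add, hr' _ x.2, hr' _ y.2]; simp) }
  have hf : ∀ x, algebraMap F M (f x) = g x := fun x => hr' _ x.2
  have h1 := halg.ringHom_of_comp_eq f g (fun x y hxy => Subtype.ext (g.toRingHom.injective (by
    have := congrArg (algebraMap F M) hxy
    rwa [hf, hf] at this))) (RingHom.ext hf)
  rw [hg, isAlgebraic_algebraMap_iff hM] at h1
  exact Polynomial.transcendental (j d) hd.ne' (mem_nonZeroDivisors_of_ne_zero (by
    intro h; rw [leadingCoeff_eq_zero] at h; simp [h] at hd)) h1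

theorem forall_isIntegralElem {D F : Type*} [CommRing D] [Field F] (j : D →+* F[X])
    (k : Subfield F) (hk : ∀ a ∈ k, j.IsIntegralElem (C a)) (ζ : F[X]) (d : D)
    (hd : 0 < (j d).natDegree) (hP : ∃ P : F[X], (∀ i, P.coeff i ∈ k) ∧ j d = P.comp ζ)
    (f : F[X]) (hf : ∃ P : F[X], (∀ i, P.coeff i ∈ k) ∧ f = P.comp ζ) : j.IsIntegralElem f := by
  let := j.toAlgebra
  change IsIntegral D f
  have hk' : ∀ a ∈ k, IsIntegral D (C a : F[X]) := hk
  obtain ⟨P, hP, hPd⟩ := hP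
  have hPdeg : P.natDegree ≠ 0 := by
    intro h
    rw [hPd, natDegree_comp, h] at hd
    simp at hd
  have hP0 : P.leadingCoeff ≠ 0 := by
    intro h; rw [leadingCoeff_eq_zero] at h; simp [h] at hPdeg
  have hl : P.leadingCoeff⁻¹ ∈ k := k.inv_mem (hP _)
  have hζ : IsIntegral D ζ := by
    refine IsIntegral.of_aeval_monic_of_isIntegral_coeff
      (p := (C P.leadingCoeff⁻¹ * P).map (C : F →+* F[X])) ?_ ?_ ?_ ?_
    · refine Monic.map _ ?_
      rw [Monic, leadingCoeff_mul, leadingCoeff_C, inv_mul_cancel₀ hP0]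
    · rw [natDegree_map_eq_of_injective C_injective, natDegree_C_mul (inv_ne_zero hP0)]
      exact hPdeg
    · rw [eval_map, eval₂_mul, eval₂_C]
      refine (hk' _ hl).mul ?_
      change IsIntegral D (P.comp ζ)
      rw [← hPd]
      exact isIntegral_algebraMap (R := D) (x := d)
    · intro i
      rw [coeff_map, coeff_C_mul]
      exact hk' _ (k.mul_mem hl (hP i))
  obtain ⟨Q, hQ, rfl⟩ := hf
  rw [comp_eq_sum_left, sum_def]
  exact IsIntegral.sum _ fun i _ => (hk' _ (hQ i)).mul (hζ.pow i)

open Cardinal in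
theorem exists_generator_of_natDegree_pos {K D F τ : Type u} [Finite τ] [Field K] [CommRing D]
    [IsDomain D] [Field F] [Algebra K D] [Algebra K F] (ψ : MvPolynomial τ D →ₐ[K] F[X])
    (hψ : Function.Injective ψ)
    (hloc : ∀ p : F[X], ∃ r r' : MvPolynomial τ D, ∃ b : F, b ≠ 0 ∧ ψ r = C b ∧ C b * p = ψ r')
    (htrD : Algebra.trdeg K D = 1) (htrF : Algebra.trdeg K F = #τ) (d : D)
    (hd : 0 < (ψ (MvPolynomial.C d)).natDegree) :
    ∃ (k : Subfield F) (ζ : D), 0 < (ψ (MvPolynomial.C ζ)).natDegree ∧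
      (∀ a ∈ k, ∃ x, ψ (MvPolynomial.C x) = C a) ∧
      ∀ x, ∃ P : F[X], (∀ i, P.coeff i ∈ k) ∧
        ψ (MvPolynomial.C x) = P.comp (ψ (MvPolynomial.C ζ)) := by
  let R := MvPolynomial τ D
  let M := FractionRing F[X]
  let E := FractionRing (MvPolynomial τ R)
  have hMinj : Function.Injective (algebraMap F[X] M) := IsFractionRing.injective _ _
  let algRM : Algebra R M := ((algebraMap F[X] M).comp (ψ : R →+* F[X])).toAlgebra
  have algRM_apply : ∀ r : R, algebraMap R M r = algebraMap F[X] M (ψ r) := fun _ => rfl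
  have : FaithfulSMul R M := (faithfulSMul_iff_algebraMap_injective R M).2 (hMinj.comp hψ)
  have : IsFractionRing R M := by
    refine IsFractionRing.of_field R M fun z => ?_
    obtain ⟨p, q, hq, rfl⟩ := IsFractionRing.div_surjective (A := F[X]) z
    obtain ⟨r, r', b, hb, h1, h2⟩ := hloc p
    obtain ⟨s, s', c, hc, h3, h4⟩ := hloc q
    have hq0 : algebraMap F[X] M q ≠ 0 := by
      rw [Ne, map_eq_zero_iff _ hMinj]; exact nonZeroDivisors.ne_zero hq
    have hb0 : algebraMap F[X] M (C b) ≠ 0 := by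
      rw [Ne, map_eq_zero_iff _ hMinj, C_eq_zero]; exact hb
    have hc0 : algebraMap F[X] M (C c) ≠ 0 := by
      rw [Ne, map_eq_zero_iff _ hMinj, C_eq_zero]; exact hc
    refine ⟨r' * s, r * s', ?_⟩
    rw [algRM_apply, algRM_apply, map_mul ψ, map_mul ψ, h1, ← h2, h3, ← h4]
    simp only [map_mul]
    rw [div_eq_div_iff hq0 (mul_ne_zero hb0 (mul_ne_zero hc0 hq0))]
    ring
  let ι : M →+* E := inclLeft D τ M
  let σ : M →+* E := inclRight D τ M
  have hισ : ∀ x : D, ι (algebraMap F[X] M (ψ (MvPolynomial.C x))) =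
      σ (algebraMap F[X] M (ψ (MvPolynomial.C x))) := fun x => inclLeft_eq_inclRight_C D τ M x
  have hcK : ∀ r : K, (C (algebraMap K F r) : F[X]) = ψ (MvPolynomial.C (algebraMap K D r)) := by
    intro r
    rw [← MvPolynomial.algebraMap_eq, ← IsScalarTower.algebraMap_apply K D (MvPolynomial τ D),
      AlgHom.commutes]
    rfl
  have hιK : ∀ r : K, ι (algebraMap F[X] M (C (algebraMap K F r))) = algebraMap K E r := by
    intro r
    rw [hcK, ← algRM_apply]
    rw [show ι = inclLeft D τ M from rfl, inclLeft_algebraMap,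
      IsScalarTower.algebraMap_apply K (MvPolynomial τ R) E,
      IsScalarTower.algebraMap_apply K R (MvPolynomial τ R),
      IsScalarTower.algebraMap_apply K D R]
    rfl
  let i : F →ₐ[K] E := { (ι.comp (algebraMap F[X] M)).comp C with commutes' := hιK }
  let s : F →ₐ[K] E := { (σ.comp (algebraMap F[X] M)).comp C with
    commutes' := fun r => by
      rw [← hιK, hcK]
      exact ((hισ _).trans (congrArg (fun z => σ (algebraMap F[X] M z)) (hcK r).symm)).symm }
  have hi : ∀ f : F[X], eval₂ (i : F →+* E) (ι (algebraMap F[X] M X)) f =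
      ι (algebraMap F[X] M f) := by
    intro f
    conv_rhs => rw [← eval₂_C_X (p := f)]
    exact (hom_eval₂ f C (ι.comp (algebraMap F[X] M)) X).symm
  have hs : ∀ f : F[X], eval₂ (s : F →+* E) (σ (algebraMap F[X] M X)) f =
      σ (algebraMap F[X] M f) := by
    intro f
    conv_rhs => rw [← eval₂_C_X (p := f)]
    exact (hom_eval₂ f C (σ.comp (algebraMap F[X] M)) X).symm
  have hF : Algebra.trdeg K F + Algebra.trdeg K F < Algebra.trdeg K E := by
    rw [trdeg_fractionRing, trdeg_mvPolynomial, trdeg_mvPolynomial, htrD, htrF]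
    obtain ⟨n, hn⟩ := Cardinal.lt_aleph0.1 (Cardinal.lt_aleph0_of_finite τ)
    rw [hn]
    norm_cast
    omega
  let N : Subfield E := Subfield.closure (Set.range i ∪ Set.range s)
  have hgen : ∀ E' : Subfield E, (∀ a, i a ∈ E') → (∀ a, s a ∈ E') →
      ι (algebraMap F[X] M X) ∈ E' → σ (algebraMap F[X] M X) ∈ E' → E' = ⊤ := by
    intro E' h1 h2 h3 h4
    refine subfield_eq_top_of_incl_mem M E' (fun p => ?_) (fun p => ?_)
    · rw [algRM_apply]
      change ι (algebraMap F[X] M (ψ p)) ∈ E'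
      rw [← hi, eval₂_eq_sum_range]
      exact E'.sum_mem fun j _ => E'.mul_mem (h1 _) (E'.pow_mem h3 _)
    · rw [algRM_apply]
      change σ (algebraMap F[X] M (ψ p)) ∈ E'
      rw [← hs, eval₂_eq_sum_range]
      exact E'.sum_mem fun j _ => E'.mul_mem (h2 _) (E'.pow_mem h4 _)
  obtain ⟨ζ, hζ0, hζ1, hζ2⟩ := exists_generator_of_eqLocus ι σ N
    (fun a => Subfield.subset_closure (Or.inl ⟨a, rfl⟩))
    (fun a => Subfield.subset_closure (Or.inr ⟨a, rfl⟩))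
    (fun f hf hfe => transcendental_of_lt_trdeg i s hF N rfl _ _ hgen f hf _ (hi f)
      ((hs f).trans hfe.symm))
    (ψ (MvPolynomial.C d)) hd (hισ d)
  let k : Subfield F := RingHom.eqLocusField ((ι.comp (algebraMap F[X] M)).comp C)
    ((σ.comp (algebraMap F[X] M)).comp C)
  let A : Subring F[X] := RingHom.eqLocus (ι.comp (algebraMap F[X] M)) (σ.comp (algebraMap F[X] M))
  let j : D →ₐ[K] F[X] := ψ.comp (IsScalarTower.toAlgHom K D R)
  have hj : Function.Injective j := hψ.comp (MvPolynomial.C_injective _ _)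
  have hfrac : ∀ f ∈ A, ∃ a b : D, b ≠ 0 ∧ f * ψ (MvPolynomial.C b) = ψ (MvPolynomial.C a) := by
    intro f hf
    obtain ⟨a, b, hb, h⟩ := exists_mul_eq_of_inclLeft_eq_inclRight D τ M hf
    refine ⟨a, b, hb, hMinj ?_⟩
    rw [map_mul]
    exact h
  have hkint : ∀ a ∈ k, (j : D →+* F[X]).IsIntegralElem (C a) := by
    intro q hq
    obtain ⟨a, b, hb, h⟩ := hfrac (C q) hq
    have halg := isAlgebraic_of_C_mul_eq j hj htrD d hd q a b hb h
    have hint : IsIntegral K (C q : F[X]) :=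
      halg.isIntegral.map (IsScalarTower.toAlgHom K F F[X])
    let : Algebra D F[X] := (j : D →+* F[X]).toAlgebra
    have : IsScalarTower K D F[X] := IsScalarTower.of_algebraMap_eq fun x => (j.commutes x).symm
    exact hint.tower_top (A := D)
  have key := forall_mem_range_of_isIntegral (ψ : R →+* F[X]) hψ hloc k A hισ hfrac
    (fun a => Iff.rfl) (fun f hf => forall_isIntegralElem (j : D →+* F[X]) k hkint ζ d hd
      (hζ2 _ (hισ d)) f (hζ2 f hf)) ζ hζ1 hζ2
  obtain ⟨z, hz⟩ := key ζ hζ1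
  have hz' : ψ (MvPolynomial.C z) = ζ := hz
  refine ⟨k, z, by rw [hz']; exact hζ0, fun a ha => key (C a) ha, fun x => ?_⟩
  rw [hz']
  exact hζ2 _ (hισ x)

theorem natDegree_eq_zero_of_comp {F : Type*} [Field F] {P ζ : F[X]} {a : F} (hζ : 0 < ζ.natDegree)
    (h : C a = P.comp ζ) : P = C a := by
  apply comp_left_injective_of_natDegree_pos hζ
  simp [h.symm]

theorem exists_bijective_eval₂RingHom {D F : Type*} [CommRing D]
    [IsDomain D] [Field F] (j : D →+* F[X]) (hj : Function.Injective j)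
    (k : Subfield F) (ζ : D) (hζ : 0 < (j ζ).natDegree) (hk : ∀ a ∈ k, ∃ x, j x = C a)
    (hP : ∀ x, ∃ P : F[X], (∀ i, P.coeff i ∈ k) ∧ j x = P.comp (j ζ)) :
    ∃ K : Subring D, IsField K ∧ (∀ v : D, IsUnit v → v ∈ K) ∧
      ∃ z : D, Function.Bijective (eval₂RingHom K.subtype z) := by
  have hkmem : ∀ x a, j x = C a → a ∈ k := by
    intro x a hx
    obtain ⟨P, hP, h⟩ := hP x
    have := natDegree_eq_zero_of_comp hζ (hx.symm.trans h)
    simpa [this] using hP 0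
  let K : Subring D := (C : F →+* F[X]).range.comap j
  have hK : ∀ x : D, x ∈ K ↔ ∃ a, C a = j x := fun x => Iff.rfl
  refine ⟨K, ⟨⟨0, 1, zero_ne_one⟩, mul_comm, ?_⟩, ?_, ζ, ?_, ?_⟩
  · rintro ⟨x, hx⟩ hx0
    obtain ⟨a, ha⟩ := (hK x).1 hx
    have ha0 : a ≠ 0 := by
      rintro rfl
      rw [map_zero] at ha
      exact hx0 (Subtype.ext (hj (ha.symm.trans (map_zero j).symm)))
    obtain ⟨y, hy⟩ := hk _ (k.inv_mem (hkmem x a ha.symm))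
    refine ⟨⟨y, (hK y).2 ⟨_, hy.symm⟩⟩, Subtype.ext (hj ?_)⟩
    change j (x * y) = j 1
    rw [map_mul, hy, ← ha, ← C_mul, mul_inv_cancel₀ ha0, map_one, map_one]
  · intro v hv
    obtain ⟨a, -, ha⟩ := Polynomial.isUnit_iff.1 (hv.map j)
    exact (hK v).2 ⟨a, ha⟩
  · have hc : ∀ x : K, ∃ a, C a = j x := fun x => (hK x).1 x.2
    rw [injective_iff_map_eq_zero]
    intro p hp
    let f : K →+* F := constantCoeff.comp (j.comp K.subtype)
    have hf : ∀ x : K, j x = C (f x) := by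
      intro x
      obtain ⟨a, ha⟩ := hc x
      change _ = C (constantCoeff (j x))
      rw [← ha]; simp
    have h1 : (p.map f).comp (j ζ) = (0 : F[X]).comp (j ζ) := by
      rw [zero_comp, ← map_zero j, ← hp, comp, eval₂_map]
      change _ = j (eval₂ _ _ _)
      rw [hom_eval₂]
      congr 1
      exact RingHom.ext fun x => (hf x).symm
    have h2 := comp_left_injective_of_natDegree_pos hζ h1
    have hfi : Function.Injective f := fun x y h => Subtype.ext (hj (by rw [hf, hf, h]))
    exact Polynomial.map_injective f hfi (by rw [h2, Polynomial.map_zero])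
  · intro x
    obtain ⟨P, hPk, h⟩ := hP x
    have : ∀ i, ∃ y : K, j y = C (P.coeff i) := fun i => by
      obtain ⟨y, hy⟩ := hk _ (hPk i)
      exact ⟨⟨y, (hK y).2 ⟨_, hy.symm⟩⟩, hy⟩
    choose y hy using this
    refine ⟨∑ i ∈ Finset.range (P.natDegree + 1), C (y i) * X ^ i, hj ?_⟩
    rw [h, comp, eval₂_eq_sum_range, map_sum, map_sum]
    refine Finset.sum_congr rfl fun i _ => ?_
    simp [hy]

open Cardinal in
theorem exists_subring_bijective_eval₂RingHom {K D B τ : Type u} [Finite τ] [Field K] [CommRing D]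
    [IsDomain D] [Algebra K D] [CommRing B] [IsDomain B] (e : MvPolynomial τ D ≃+* B[X])
    (htr : Algebra.trdeg K D = 1) (d : D) (hd : 0 < (e (MvPolynomial.C d)).natDegree) :
    ∃ K : Subring D, IsField K ∧ (∀ v : D, IsUnit v → v ∈ K) ∧
      ∃ z : D, Function.Bijective (eval₂RingHom K.subtype z) := by
  let f : K →+* B :=
    constantCoeff.comp ((e : _ →+* B[X]).comp (algebraMap K (MvPolynomial τ D)))
  let algB : Algebra K B := f.toAlgebra
  have hf : ∀ r : K, e (algebraMap K _ r) = C (f r) := by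
    intro r
    rcases eq_or_ne r 0 with rfl | hr
    · simp
    · have : IsUnit (e (algebraMap K (MvPolynomial τ D) r)) :=
        ((hr.isUnit).map (algebraMap K (MvPolynomial τ D))).map e
      obtain ⟨a, -, ha⟩ := Polynomial.isUnit_iff.1 this
      change _ = C (constantCoeff (e (algebraMap K (MvPolynomial τ D) r)))
      rw [← ha]; simp
  let e' : MvPolynomial τ D ≃ₐ[K] B[X] := AlgEquiv.ofRingEquiv (f := e) hf
  let F := FractionRing B
  have hBF : Function.Injective (algebraMap B F) := IsFractionRing.injective _ _
  let ψ : MvPolynomial τ D →ₐ[K] F[X] :=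
    (Polynomial.mapAlgHom (IsScalarTower.toAlgHom K B F)).comp (e' : _ →ₐ[K] B[X])
  have hψa : ∀ r, ψ r = (e r).map (algebraMap B F) := fun _ => rfl
  have hψ : Function.Injective ψ := (Polynomial.map_injective _ hBF).comp e.injective
  have hloc : ∀ p : F[X], ∃ r r' : MvPolynomial τ D, ∃ b : F,
      b ≠ 0 ∧ ψ r = C b ∧ C b * p = ψ r' := by
    intro p
    obtain ⟨b, hbm, hb⟩ := IsLocalization.integerNormalization_spec (nonZeroDivisors B) p
    refine ⟨e.symm (C b), e.symm (IsLocalization.integerNormalization (nonZeroDivisors B) p),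
      algebraMap B F b, ?_, ?_, ?_⟩
    · rw [Ne, map_eq_zero_iff _ hBF]; exact nonZeroDivisors.ne_zero hbm
    · rw [hψa, RingEquiv.apply_symm_apply, map_C]
    · rw [hψa, RingEquiv.apply_symm_apply, hb]
      ext i
      rw [coeff_C_mul, coeff_smul, Algebra.smul_def]
  have htrF : Algebra.trdeg K F = #τ := by
    rw [trdeg_fractionRing]
    have := e'.trdeg_eq
    rw [trdeg_mvPolynomial, trdeg_polynomial, htr, add_comm] at this
    exact (Cardinal.add_one_inj.1 this).symm
  obtain ⟨k, ζ, h1, h2, h3⟩ := exists_generator_of_natDegree_pos ψ hψ hloc htr htrF d (by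
    rw [hψa, natDegree_map_eq_of_injective hBF]; exact hd)
  let j : D →+* F[X] := (ψ.toRingHom).comp MvPolynomial.C
  have hj : Function.Injective j := hψ.comp (MvPolynomial.C_injective _ _)
  exact exists_bijective_eval₂RingHom j hj k ζ h1 h2 h3

end

section
open Polynomial

theorem MvPolynomial.exists_algEquiv_natDegree_pos {R : Type*} [CommRing R] {n : ℕ}
    (p : MvPolynomial (Fin n) R) (hp : ∀ r, p ≠ MvPolynomial.C r) :
    ∃ (m : ℕ) (e : MvPolynomial (Fin n) R ≃ₐ[R] (MvPolynomial (Fin m) R)[X]),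
      0 < (e p).natDegree := by
  have h1 : ∃ i, p.degreeOf i ≠ 0 := by
    by_contra! h
    have h2 : p.vars = ∅ := by
      ext i
      have := h i
      simp only [Finset.notMem_empty, iff_false]
      rw [MvPolynomial.degreeOf_def] at this
      rw [MvPolynomial.vars_def]
      simpa using this
    exact hp _ (MvPolynomial.vars_eq_empty_iff_eq_C.1 h2)
  obtain ⟨i, hi⟩ := h1
  obtain ⟨m, rfl⟩ : ∃ m, n = m + 1 := ⟨n - 1, by have := i.2; omega⟩
  refine ⟨m, (MvPolynomial.renameEquiv R (Equiv.swap i 0)).trans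
    (MvPolynomial.finSuccEquiv R m), ?_⟩
  rw [AlgEquiv.trans_apply, MvPolynomial.natDegree_finSuccEquiv, MvPolynomial.renameEquiv_apply]
  have := MvPolynomial.degreeOf_rename_of_injective (p := p) (Equiv.swap i 0).injective i
  rw [Equiv.swap_apply_left] at this
  rw [this]
  exact Nat.pos_of_ne_zero hi

theorem MvPolynomial.exists_eq_C_of_isAlgebraic {R : Type*} [CommRing R] [IsDomain R] {n : ℕ}
    {p : MvPolynomial (Fin n) R} (hp : IsAlgebraic R p) : ∃ r, p = MvPolynomial.C r := by
  by_contra! h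
  obtain ⟨m, e, he⟩ := exists_algEquiv_natDegree_pos p h
  have h1 := (hp.algHom e.toAlgHom).extendScalars
    (S := MvPolynomial (Fin m) R) (MvPolynomial.C_injective _ _)
  refine Polynomial.transcendental (e p) he.ne' (mem_nonZeroDivisors_of_ne_zero fun h => ?_) h1
  rw [leadingCoeff_eq_zero] at h
  simp [h] at he

theorem exists_field_trdeg_eq_one {D : Type u} [CommRing D] [IsDomain D] (K : Subring D)
    (hK : IsField K) (x : D) (hx : IsTranscendenceBasis K (fun _ : Unit => x)) :
    ∃ (K : Type u) (_ : Field K) (_ : Algebra K D), Algebra.trdeg K D = 1 := by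
  refine ⟨K, hK.toField, (inferInstance : Algebra K D), ?_⟩
  have := hx.lift_cardinalMk_eq_trdeg
  rw [Cardinal.lift_id'.{0, u}] at this
  rw [Cardinal.mk_punit, Cardinal.lift_one] at this
  exact this.symm

theorem exists_forall_eq_C_of_trdeg_eq_one {K D E : Type u} [Field K] [CommRing D]
    [IsDomain D] [Algebra K D] [CommRing E] {n : ℕ}
    (φ : MvPolynomial (Fin n) D ≃+* MvPolynomial (Fin n) E) (htr : Algebra.trdeg K D = 1)
    (hD : ¬ ∃ L : Subring D, IsField L ∧ (∀ v : D, IsUnit v → v ∈ L) ∧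
      ∃ z : D, Function.Bijective (eval₂RingHom L.subtype z)) :
    (∀ d, ∃ c, φ (MvPolynomial.C d) = MvPolynomial.C c) ∧
      ∀ c, ∃ d, φ (MvPolynomial.C d) = MvPolynomial.C c := by
  have : IsDomain (MvPolynomial (Fin n) E) := φ.symm.toMulEquiv.isDomain _
  have : IsDomain E := (MvPolynomial.C_injective (Fin n) E).isDomain MvPolynomial.C
  have h1 : ∀ d, ∃ c, φ (MvPolynomial.C d) = MvPolynomial.C c := by
    intro d
    by_contra! h
    obtain ⟨m, e, he⟩ := MvPolynomial.exists_algEquiv_natDegree_pos _ h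
    refine hD (exists_subring_bijective_eval₂RingHom (τ := ULift.{u} (Fin n))
      ((MvPolynomial.renameEquiv D Equiv.ulift).toRingEquiv.trans (φ.trans e.toRingEquiv)) htr d ?_)
    simpa using he
  refine ⟨h1, fun c => ?_⟩
  choose j hj using h1
  let J : D →+* E := MvPolynomial.constantCoeff.comp (φ.toRingHom.comp MvPolynomial.C)
  have hJ : ∀ d, φ (MvPolynomial.C d) = MvPolynomial.C (J d) := by
    intro d
    change _ = MvPolynomial.C (MvPolynomial.constantCoeff (φ (MvPolynomial.C d)))
    rw [hj]; simp
  let _ : Algebra D E := J.toAlgebra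
  have hJinj : Function.Injective (algebraMap D E) := by
    intro x y hxy
    apply MvPolynomial.C_injective (Fin n) D
    apply φ.injective
    rw [hJ, hJ]
    exact congrArg _ hxy
  have : FaithfulSMul D E := (faithfulSMul_iff_algebraMap_injective D E).2 hJinj
  let Φ : MvPolynomial (Fin n) D ≃ₐ[D] MvPolynomial (Fin n) E := AlgEquiv.ofRingEquiv (f := φ) hJ
  have h2 : Algebra.trdeg D E = 0 := by
    have h := Φ.trdeg_eq
    rw [← trdeg_add_eq D E (A := MvPolynomial (Fin n) E), MvPolynomial.trdeg_of_isDomain,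
      MvPolynomial.trdeg_of_isDomain] at h
    obtain ⟨N, hN⟩ : ∃ N : ℕ, Algebra.trdeg D E = N := by
      apply Cardinal.lt_aleph0.1
      refine lt_of_le_of_lt (self_le_add_right _ _) (h.symm.trans_lt ?_)
      simp
    rw [hN] at h ⊢
    simp only [Cardinal.mk_fin, Cardinal.lift_natCast] at h
    norm_cast at h ⊢
    omega
  have : Algebra.IsAlgebraic D E := trdeg_eq_zero_iff.1 h2
  have h3 : IsAlgebraic D (Φ.symm (MvPolynomial.C c)) :=
    ((Algebra.IsAlgebraic.isAlgebraic c).algHom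
      (IsScalarTower.toAlgHom D E (MvPolynomial (Fin n) E))).algHom Φ.symm.toAlgHom
  obtain ⟨d, hd⟩ := MvPolynomial.exists_eq_C_of_isAlgebraic h3
  refine ⟨d, ?_⟩
  rw [← hd]
  exact Φ.apply_symm_apply _

theorem exists_subalgebra_polynomial_of_subring {k D : Type*} [Field k] [CommRing D] [Algebra k D]
    (L : Subring D) (hL : IsField L) (hu : ∀ v : D, IsUnit v → v ∈ L)
    (z : D) (hz : Function.Bijective (eval₂RingHom L.subtype z)) :
    ∃ K' : Subalgebra k D, IsField K' ∧ Nonempty (D ≃ₐ[k] K'[X]) := by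
  let K' : Subalgebra k D :=
    { L with
      algebraMap_mem' := fun r => by
        rcases eq_or_ne r 0 with rfl | hr
        · rw [map_zero]; exact L.zero_mem
        · exact hu _ (hr.isUnit.map _) }
  refine ⟨K', hL, ⟨(AlgEquiv.ofBijective
    ((Polynomial.aeval (R := K') z).restrictScalars k) hz).symm⟩⟩
end

section

theorem MvPolynomial.bijective_of_isNilpotent_sub {R σ : Type*} [CommRing R] [Finite σ]
    (ε : MvPolynomial σ R →ₐ[R] MvPolynomial σ R)
    (h : ∀ i, IsNilpotent (ε (X i) - X i)) : Function.Bijective ε := by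
  cases nonempty_fintype σ
  classical
  let s : Finset R := Finset.univ.biUnion fun i =>
    (ε (X i) - X i).support.image fun γ => (ε (X i) - X i).coeff γ
  let I : Ideal R := Ideal.span s
  have hI : IsNilpotent I := by
    rw [Ideal.FG.isNilpotent_iff_le_nilradical ⟨s, rfl⟩, Ideal.span_le]
    intro a ha
    simp only [s, Finset.coe_biUnion, Set.mem_iUnion, Finset.coe_image] at ha
    obtain ⟨i, -, γ, -, rfl⟩ := ha
    exact MvPolynomial.isNilpotent_iff.1 (h i) γ
  have hX : ∀ i, ε (X i) - X i ∈ I.map (C : R →+* MvPolynomial σ R) := by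
    intro i
    rw [MvPolynomial.mem_map_C_iff]
    intro γ
    by_cases hγ : γ ∈ (ε (X i) - X i).support
    · refine Ideal.subset_span ?_
      simp only [s, Finset.coe_biUnion, Set.mem_iUnion, Finset.coe_image]
      exact ⟨i, by simp, γ, hγ, rfl⟩
    · rw [MvPolynomial.notMem_support_iff.1 hγ]; exact I.zero_mem
  have hp : ∀ p, ε p - p ∈ I.map (C : R →+* MvPolynomial σ R) := by
    intro p
    rw [← Ideal.Quotient.eq]
    have : (Ideal.Quotient.mkₐ R (I.map (C : R →+* MvPolynomial σ R))).comp ε =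
        Ideal.Quotient.mkₐ R (I.map (C : R →+* MvPolynomial σ R)) := by
      ext i
      exact Ideal.Quotient.eq.2 (hX i)
    exact DFunLike.congr_fun this p
  let δ : Module.End R (MvPolynomial σ R) := ε.toLinearMap - 1
  have hδ : ∀ n : ℕ, ∀ p, (δ ^ n) p ∈ (I ^ n • ⊤ : Submodule R (MvPolynomial σ R)) := by
    intro n
    induction n with
    | zero => intro p; rw [pow_zero, Ideal.one_eq_top, Submodule.top_smul]; trivial
    | succ n ih =>
      intro p
      have h1 := Submodule.mem_map_of_mem (f := δ) (ih p)
      rw [Submodule.map_smul''] at h1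
      have h2 : Submodule.map δ ⊤ ≤ I • ⊤ := by
        rintro _ ⟨q, -, rfl⟩
        rw [Ideal.smul_top_eq_map]
        exact hp q
      rw [pow_succ' δ, pow_succ I, ← smul_eq_mul (a := I ^ n), Submodule.smul_assoc]
      exact Submodule.smul_mono le_rfl h2 h1
  obtain ⟨n, hn⟩ := hI
  have hnil : IsNilpotent δ := by
    refine ⟨n, LinearMap.ext fun p => ?_⟩
    have := hδ n p
    rw [hn, Ideal.zero_eq_bot, Submodule.bot_smul] at this
    exact (Submodule.mem_bot R).1 this
  have h1 := hnil.isUnit_one_add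
  rw [show 1 + δ = ε.toLinearMap by simp [δ], Module.End.isUnit_iff] at h1
  exact h1

theorem MvPolynomial.exists_coeff_eq_or {R S σ : Type*} [CommRing R] [CommRing S] (f : R → S)
    (p : MvPolynomial σ R) : ∃ q : MvPolynomial σ S,
      ∀ γ, q.coeff γ = f (p.coeff γ) ∨ (p.coeff γ = 0 ∧ q.coeff γ = 0) := by
  classical
  refine ⟨∑ γ ∈ p.support, monomial γ (f (p.coeff γ)), fun γ => ?_⟩
  rw [coeff_sum]
  simp only [coeff_monomial]
  rw [Finset.sum_ite_eq']
  split_ifs with h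
  · exact Or.inl rfl
  · exact Or.inr ⟨notMem_support_iff.1 h, rfl⟩

theorem MvPolynomial.eval₂_eq_eval₂ {R S T σ : Type*} [Fintype σ] [CommRing R] [CommRing S]
    [CommRing T] (f : R →+* T) (g : S →+* T) (x : σ → T) (p : MvPolynomial σ R)
    (q : MvPolynomial σ S) (h : ∀ γ, f (p.coeff γ) = g (q.coeff γ)) :
    p.eval₂ f x = q.eval₂ g x := by
  classical
  rw [eval₂_eq', eval₂_eq',
    Finset.sum_subset (Finset.subset_union_left (s₁ := p.support) (s₂ := q.support)),
    Finset.sum_subset (s₁ := q.support) (Finset.subset_union_right (s₁ := p.support))]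
  · exact Finset.sum_congr rfl fun γ _ => by rw [h]
  · intro γ _ hγ
    rw [notMem_support_iff.1 hγ, map_zero, zero_mul]
  · intro γ _ hγ
    rw [notMem_support_iff.1 hγ, map_zero, zero_mul]

theorem MvPolynomial.isNilpotent_sub_aeval {R S : Type*} {σ : Type*} [Finite σ] [CommRing R]
    [CommRing S] (φ : MvPolynomial σ R →+* MvPolynomial σ S) (p : MvPolynomial σ R)
    (q : MvPolynomial σ S) (h : ∀ γ, IsNilpotent (φ (C (p.coeff γ)) - C (q.coeff γ))) :
    IsNilpotent (φ p - aeval (fun i => φ (X i)) q) := by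
  cases nonempty_fintype σ
  let π := Ideal.Quotient.mk (nilradical (MvPolynomial σ S))
  have hπ : ∀ a b, IsNilpotent (a - b) ↔ π a = π b := fun a b => by
    rw [Ideal.Quotient.eq, mem_nilradical]
  rw [hπ]
  have h1 := eval₂_eq_eval₂ ((π.comp φ).comp C) (π.comp C) (fun i => π (φ (X i))) p q
    (fun γ => (hπ _ _).1 (h γ))
  have h2 : π (φ p) = p.eval₂ ((π.comp φ).comp C) (fun i => π (φ (X i))) := by
    conv_lhs => rw [← eval₂_eta p]
    exact hom_eval₂ p C (π.comp φ) X
  have h3 : π (aeval (fun i => φ (X i)) q) = q.eval₂ (π.comp C) (fun i => π (φ (X i))) := by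
    rw [aeval_def]
    exact hom_eval₂ q _ π _
  rw [h2, h3, h1]

theorem MvPolynomial.bijective_aeval_of_isNilpotent_sub {R S : Type*} {σ : Type*} [Finite σ]
    [CommRing R] [CommRing S] (φ : MvPolynomial σ R ≃+* MvPolynomial σ S)
    (h1 : ∀ r, ∃ s, IsNilpotent (φ (C r) - C s)) (h2 : ∀ s, ∃ r, IsNilpotent (φ (C r) - C s)) :
    Function.Bijective (aeval (R := S) fun i => φ (X i)) := by
  choose f hf using h1
  choose g hg using h2
  set η : MvPolynomial σ S →ₐ[S] MvPolynomial σ S := aeval fun i => φ (X i) with hη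
  have hinj : ∀ q, IsNilpotent (η q) → IsNilpotent q := by
    intro q hq
    obtain ⟨p, hp⟩ := exists_coeff_eq_or g q
    have hpq : ∀ γ, IsNilpotent (φ (C (p.coeff γ)) - C (q.coeff γ)) := by
      intro γ
      rcases hp γ with h | ⟨h, h'⟩
      · rw [h]; exact hg _
      · rw [h, h']; simp
    have h3 := isNilpotent_sub_aeval (φ : MvPolynomial σ R →+* MvPolynomial σ S) p q hpq
    have h4 : IsNilpotent (φ p) := by
      have := (Commute.all _ _).isNilpotent_add h3 hq
      simpa [hη] using this
    have h5 : IsNilpotent p := by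
      have := h4.map φ.symm
      simpa using this
    rw [isNilpotent_iff] at h5 ⊢
    intro γ
    have h6 : IsNilpotent (φ (C (p.coeff γ))) := ((h5 γ).map C).map φ
    have h7 := (Commute.all _ _).isNilpotent_sub h6 (hpq γ)
    rw [sub_sub_cancel] at h7
    have h8 := isNilpotent_iff.1 h7 0
    simpa using h8
  have hθ : ∀ j, ∃ q, IsNilpotent (X j - η q) := by
    intro j
    obtain ⟨q, hq⟩ := exists_coeff_eq_or f (φ.symm (X j))
    refine ⟨q, ?_⟩
    have h3 := isNilpotent_sub_aeval (φ : MvPolynomial σ R →+* MvPolynomial σ S)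
      (φ.symm (X j)) q (fun γ => by
        rcases hq γ with h | ⟨h, h'⟩
        · rw [h]; exact hf _
        · rw [h, h']; simp)
    simpa [hη] using h3
  choose x hx using hθ
  let θ : MvPolynomial σ S →ₐ[S] MvPolynomial σ S := aeval x
  have hηθ : ∀ p, IsNilpotent ((η.comp θ) p - p) := by
    let π := Ideal.Quotient.mkₐ S (nilradical (MvPolynomial σ S))
    have : π.comp (η.comp θ) = π := by
      ext i
      refine Ideal.Quotient.eq.2 ?_
      rw [mem_nilradical, ← neg_sub, isNilpotent_neg_iff]
      simpa [θ] using hx i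
    intro p
    rw [← mem_nilradical, ← Ideal.Quotient.eq]
    exact DFunLike.congr_fun this p
  have b1 := bijective_of_isNilpotent_sub (η.comp θ) fun i => hηθ _
  have b2 := bijective_of_isNilpotent_sub (θ.comp η) fun i => by
    apply hinj
    rw [map_sub]
    exact hηθ (η (X i))
  exact ⟨Function.Injective.of_comp (f := θ) b2.1, Function.Surjective.of_comp (g := θ) b1.2⟩
end

theorem DomainTrdegOneNotPolynomial.forall_exists_eq_C {k D E : Type u} [Field k] [CommRing D]
    [Algebra k D] [CommRing E] (hD : DomainTrdegOneNotPolynomial k D) {n : ℕ}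
    (φ : MvPolynomial (Fin n) D ≃+* MvPolynomial (Fin n) E) :
    (∀ d, ∃ c, φ (MvPolynomial.C d) = MvPolynomial.C c) ∧
      ∀ c, ∃ d, φ (MvPolynomial.C d) = MvPolynomial.C c := by
  obtain ⟨_, ⟨K, hK, x, hx⟩, hnot⟩ := hD
  obtain ⟨K', _, _, htr⟩ := exists_field_trdeg_eq_one K hK x hx
  refine exists_forall_eq_C_of_trdeg_eq_one φ htr ?_
  rintro ⟨L, hL, hu, z, hz⟩
  exact hnot (exists_subalgebra_polynomial_of_subring L hL hu z hz)

theorem DomainTrdegOneNotPolynomial.stronglyRetractable {k D : Type u} [Field k] [CommRing D]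
    [Algebra k D] (hD : DomainTrdegOneNotPolynomial k D) : StronglyRetractable k D := by
  intro n _ B instB _ φ
  have hC : ∀ x y : PolyExt B n, x * y = y * x := fun x y => by
    obtain ⟨a, rfl⟩ := φ.surjective x
    obtain ⟨b, rfl⟩ := φ.surjective y
    rw [← map_mul, mul_comm, map_mul]
  have hB : ∀ x y : B, x * y = y * x := by
    intro x y
    have h := hC (AddMonoidAlgebra.single 0 x) (AddMonoidAlgebra.single 0 y)
    rw [AddMonoidAlgebra.single_mul_single, AddMonoidAlgebra.single_mul_single] at h
    exact AddMonoidAlgebra.single_right_injective h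
  obtain ⟨instC, rfl⟩ : ∃ c : CommRing B, c.toRing = instB := ⟨{ instB with mul_comm := hB }, rfl⟩
  obtain ⟨h1, h2⟩ := hD.forall_exists_eq_C (E := B) φ.toRingEquiv
  ext x
  constructor
  · rintro ⟨_, ⟨d, rfl⟩, rfl⟩
    obtain ⟨c, hc⟩ := h1 d
    exact ⟨c, hc.symm⟩
  · rintro ⟨c, rfl⟩
    obtain ⟨d, hd⟩ := h2 c
    exact ⟨_, ⟨d, rfl⟩, hd⟩

theorem MvPolynomial.map_nilradical_eq {R σ : Type*} [CommRing R] :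
    (nilradical R).map (C : R →+* MvPolynomial σ R) = nilradical (MvPolynomial σ R) := by
  ext p
  rw [mem_map_C_iff, mem_nilradical, isNilpotent_iff]
  rfl

theorem DomainTrdegOneNotPolynomial.forall_exists_isNilpotent_sub {k Z E : Type u} [Field k]
    [CommRing Z] [Algebra k Z] [CommRing E]
    (hD : DomainTrdegOneNotPolynomial k (Z ⧸ nilradical Z)) {n : ℕ}
    (φ : MvPolynomial (Fin n) Z ≃+* MvPolynomial (Fin n) E) :
    (∀ r, ∃ s, IsNilpotent (φ (MvPolynomial.C r) - MvPolynomial.C s)) ∧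
      ∀ s, ∃ r, IsNilpotent (φ (MvPolynomial.C r) - MvPolynomial.C s) := by
  let e (R : Type u) [CommRing R] : MvPolynomial (Fin n) (R ⧸ nilradical R) ≃+*
      (MvPolynomial (Fin n) R ⧸ nilradical (MvPolynomial (Fin n) R)) :=
    (MvPolynomial.quotientEquivQuotientMvPolynomial (nilradical R)).toRingEquiv.trans
      (Ideal.quotEquivOfEq MvPolynomial.map_nilradical_eq)
  have he : ∀ (R : Type u) [CommRing R] (r : R), e R (MvPolynomial.C (Ideal.Quotient.mk _ r)) =
      Ideal.Quotient.mk _ (MvPolynomial.C r) := by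
    intro R _ r
    change Ideal.quotEquivOfEq MvPolynomial.map_nilradical_eq (MvPolynomial.quotientEquivQuotientMvPolynomial _ _) = _
    have : MvPolynomial.quotientEquivQuotientMvPolynomial (σ := Fin n) (nilradical R)
        (MvPolynomial.C (Ideal.Quotient.mk _ r)) = Ideal.Quotient.mk _ (MvPolynomial.C r) := by
      simp [MvPolynomial.quotientEquivQuotientMvPolynomial]
    rw [this]
    rfl
  let q : (MvPolynomial (Fin n) Z ⧸ nilradical (MvPolynomial (Fin n) Z)) ≃+*
      (MvPolynomial (Fin n) E ⧸ nilradical (MvPolynomial (Fin n) E)) :=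
    Ideal.quotientEquiv _ _ φ (by
      ext p
      rw [mem_nilradical, Ideal.map_coe, Ideal.mem_map_of_equiv]
      constructor
      · intro h
        exact ⟨φ.symm p, h.map φ.symm, by simp⟩
      · rintro ⟨x, hx, rfl⟩
        exact IsNilpotent.map hx φ)
  let φ' := (e Z).trans (q.trans (e E).symm)
  have key : ∀ r s, φ' (MvPolynomial.C (Ideal.Quotient.mk _ r)) =
      MvPolynomial.C (Ideal.Quotient.mk _ s) →
      IsNilpotent (φ (MvPolynomial.C r) - MvPolynomial.C s) := by
    intro r s h
    have h1 : q (e Z (MvPolynomial.C (Ideal.Quotient.mk _ r))) =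
      e E (MvPolynomial.C (Ideal.Quotient.mk _ s)) := (e E).symm_apply_eq.1 h
    rw [he, he] at h1
    rw [← mem_nilradical, ← Ideal.Quotient.eq]
    exact h1
  obtain ⟨h1, h2⟩ := hD.forall_exists_eq_C φ'
  constructor
  · intro r
    obtain ⟨c, hc⟩ := h1 (Ideal.Quotient.mk _ r)
    obtain ⟨s, rfl⟩ := Ideal.Quotient.mk_surjective c
    exact ⟨s, key _ _ hc⟩
  · intro s
    obtain ⟨c, hc⟩ := h2 (Ideal.Quotient.mk _ s)
    obtain ⟨r, rfl⟩ := Ideal.Quotient.mk_surjective c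
    exact ⟨r, key _ _ hc⟩

theorem DomainTrdegOneNotPolynomial.bijective_aeval {k Z E : Type u} [Field k]
    [CommRing Z] [Algebra k Z] [CommRing E] (hD : DomainTrdegOneNotPolynomial k Z) {n : ℕ}
    (φ : MvPolynomial (Fin n) Z ≃+* MvPolynomial (Fin n) E) :
    Function.Bijective (MvPolynomial.aeval (R := E) fun i => φ (MvPolynomial.X i)) := by
  obtain ⟨h1, h2⟩ := hD.forall_exists_eq_C φ
  exact MvPolynomial.bijective_aeval_of_isNilpotent_sub φ
    (fun r => (h1 r).imp fun s hs => by rw [hs, sub_self]; exact IsNilpotent.zero)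
    (fun r => (h2 r).imp fun s hs => by rw [hs, sub_self]; exact IsNilpotent.zero)

theorem DomainTrdegOneNotPolynomial.bijective_aeval_of_quotient {k Z E : Type u} [Field k]
    [CommRing Z] [Algebra k Z] [CommRing E]
    (hD : DomainTrdegOneNotPolynomial k (Z ⧸ nilradical Z)) {n : ℕ}
    (φ : MvPolynomial (Fin n) Z ≃+* MvPolynomial (Fin n) E) :
    Function.Bijective (MvPolynomial.aeval (R := E) fun i => φ (MvPolynomial.X i)) := by
  obtain ⟨h1, h2⟩ := hD.forall_exists_isNilpotent_sub φ
  exact MvPolynomial.bijective_aeval_of_isNilpotent_sub φ h1 h2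

namespace PolyExt
variable {B : Type u} [Ring B] {E : Type*} [CommRing E] {n : ℕ}

/-- Extend a ring homomorphism from a commutative ring to polynomials. -/
noncomputable def mapHom (n : ℕ) (i : E →+* B) : MvPolynomial (Fin n) E →+* PolyExt B n :=
  AddMonoidAlgebra.mapRingHom _ i

/-- Constant polynomials, as a ring homomorphism. -/
noncomputable def const (B : Type u) [Ring B] (n : ℕ) : B →+* PolyExt B n :=
  AddMonoidAlgebra.singleZeroRingHom

theorem mapHom_monomial (i : E →+* B) (γ : Fin n →₀ ℕ) (e : E) :
    mapHom n i (MvPolynomial.monomial γ e) = AddMonoidAlgebra.single γ (i e) :=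
  AddMonoidAlgebra.mapRingHom_single _ _ _

theorem mapHom_C (i : E →+* B) (e : E) : mapHom n i (MvPolynomial.C e) = const B n (i e) :=
  mapHom_monomial i 0 e

theorem mapHom_X (i : E →+* B) (j : Fin n) : mapHom n i (MvPolynomial.X j) = X B n j := by
  rw [MvPolynomial.X, mapHom_monomial, map_one]; rfl

theorem coeff_mapHom (i : E →+* B) (p : MvPolynomial (Fin n) E) (γ : Fin n →₀ ℕ) :
    (mapHom n i p).coeff γ = i (p.coeff γ) :=
  AddMonoidAlgebra.coeff_mapRingHom _ _ _

theorem ringHom_ext {R : Type*} [Ring R] {f g : PolyExt B n →+* R}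
    (hC : ∀ b, f (const B n b) = g (const B n b)) (hX : ∀ j, f (X B n j) = g (X B n j)) :
    f = g := by
  have h : (f.comp (mapHom n (Int.castRingHom B)) : MvPolynomial (Fin n) ℤ →+* R) =
      g.comp (mapHom n (Int.castRingHom B)) := by
    refine MvPolynomial.ringHom_ext (fun r => ?_) fun j => ?_
    · simp
    · simpa only [RingHom.comp_apply, mapHom_X] using hX j
  refine AddMonoidAlgebra.ringHom_ext' (RingHom.ext hC) (MonoidHom.ext fun γ => ?_)
  have := RingHom.congr_fun h (MvPolynomial.monomial γ.toAdd 1)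
  simp only [RingHom.comp_apply, mapHom_monomial, map_one] at this
  exact this

theorem ringHom_mapHom {i : E →+* B}
    {η : MvPolynomial (Fin n) E →ₐ[E] MvPolynomial (Fin n) E}
    {θ : PolyExt B n →+* PolyExt B n} (hC : ∀ b, θ (const B n b) = const B n b)
    (hX : ∀ j, θ (X B n j) = mapHom n i (η (MvPolynomial.X j))) (p : MvPolynomial (Fin n) E) :
    θ (mapHom n i p) = mapHom n i (η p) := by
  have h : θ.comp (mapHom n i) = (mapHom n i).comp η.toRingHom := by
    refine MvPolynomial.ringHom_ext (fun e => ?_) fun j => ?_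
    · simp [mapHom_C, hC]
    · simp [mapHom_X, hX]
  exact RingHom.congr_fun h p

/-- A ring homomorphism which identifies `E` with the center of `B`. -/
structure IsCenter (i : E →+* B) : Prop where
  injective : Function.Injective i
  range_eq : i.range = Subring.center B

namespace IsCenter
variable {i : E →+* B} (hi : IsCenter i)
include hi

theorem mul_comm (e : E) (b : B) : i e * b = b * i e := by
  have : i e ∈ Subring.center B := hi.range_eq ▸ ⟨e, rfl⟩
  exact (Subring.mem_center_iff.1 this b).symm

theorem mapHom_mem_center (p : MvPolynomial (Fin n) E) :
    mapHom n i p ∈ Subring.center (PolyExt B n) := by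
  refine Subring.mem_center_iff.2 fun x => ?_
  induction p using MvPolynomial.induction_on' with
  | monomial γ e =>
    rw [mapHom_monomial]
    induction x using AddMonoidAlgebra.induction_linear with
    | zero => simp
    | add x y hx hy => rw [add_mul, mul_add, hx, hy]
    | single δ b =>
      rw [AddMonoidAlgebra.single_mul_single, AddMonoidAlgebra.single_mul_single, add_comm,
        hi.mul_comm]
  | add p q hp hq => rw [map_add, add_mul, mul_add, hp, hq]

theorem exists_mapHom_eq {x : PolyExt B n} (hx : x ∈ Subring.center (PolyExt B n)) :
    ∃ p, mapHom n i p = x := by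
  have h : ∀ γ, ∃ e, i e = x.coeff γ := by
    intro γ
    have : x.coeff γ ∈ Subring.center B := by
      refine Subring.mem_center_iff.2 fun b => ?_
      have := congrArg (fun y : PolyExt B n => y.coeff γ)
        (Subring.mem_center_iff.1 hx (AddMonoidAlgebra.single 0 b))
      simpa [AddMonoidAlgebra.coeff_single_zero_mul, AddMonoidAlgebra.coeff_mul_single_zero]
        using this
    rw [← hi.range_eq] at this
    exact this
  choose e he using h
  refine ⟨∑ γ ∈ x.coeff.support, MvPolynomial.monomial γ (e γ), ?_⟩
  rw [map_sum]
  simp only [mapHom_monomial, he]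
  exact AddMonoidAlgebra.sum_coeff_single x

theorem mapHom_injective : Function.Injective (mapHom n i) := by
  intro p q h
  ext γ
  apply hi.injective
  rw [← coeff_mapHom, ← coeff_mapHom, h]

/-- The center of a polynomial extension is the polynomial ring over the center. -/
noncomputable def centerEquiv (n : ℕ) :
    MvPolynomial (Fin n) E ≃+* Subring.center (PolyExt B n) :=
  RingEquiv.ofBijective ((mapHom n i).codRestrict _ hi.mapHom_mem_center)
    ⟨fun _ _ h => hi.mapHom_injective (congrArg Subtype.val h), fun x =>
      (hi.exists_mapHom_eq x.2).imp fun _ h => Subtype.ext h⟩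

theorem coe_centerEquiv (p : MvPolynomial (Fin n) E) :
    (hi.centerEquiv n p : PolyExt B n) = mapHom n i p := rfl

theorem exists_ringHom (η : MvPolynomial (Fin n) E →ₐ[E] MvPolynomial (Fin n) E) :
    ∃ θ : PolyExt B n →+* PolyExt B n, (∀ b, θ (const B n b) = const B n b) ∧
      ∀ j, θ (X B n j) = mapHom n i (η (MvPolynomial.X j)) := by
  let g : Multiplicative (Fin n →₀ ℕ) →* PolyExt B n :=
    (((mapHom n i).comp η.toRingHom : _ →+* _) : _ →* _).comp (AddMonoidAlgebra.of E (Fin n →₀ ℕ))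
  refine ⟨AddMonoidAlgebra.liftNCRingHom (const B n) g fun b γ =>
    Subring.mem_center_iff.1 (hi.mapHom_mem_center _) _, fun b => ?_, fun j => ?_⟩
  · refine (AddMonoidAlgebra.liftNCRingHom_single _ _ _ _ _).trans ?_
    change _ * g 1 = _
    rw [map_one, mul_one]
  · refine (AddMonoidAlgebra.liftNCRingHom_single _ _ _ _ _).trans ?_
    rw [map_one, one_mul]
    rfl

theorem exists_ringEquiv (η : MvPolynomial (Fin n) E ≃ₐ[E] MvPolynomial (Fin n) E) :
    ∃ θ : PolyExt B n ≃+* PolyExt B n, (∀ b, θ (const B n b) = const B n b) ∧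
      ∀ j, θ (X B n j) = mapHom n i (η (MvPolynomial.X j)) := by
  obtain ⟨θ, hC, hX⟩ := hi.exists_ringHom (η : MvPolynomial (Fin n) E →ₐ[E] _)
  obtain ⟨θ', hC', hX'⟩ := hi.exists_ringHom (η.symm : MvPolynomial (Fin n) E →ₐ[E] _)
  refine ⟨RingEquiv.ofRingHom θ θ' (ringHom_ext (fun b => ?_) fun j => ?_)
    (ringHom_ext (fun b => ?_) fun j => ?_), hC, hX⟩
  · simp [hC, hC']
  · simp [hX', ringHom_mapHom hC hX, mapHom_X]
  · simp [hC, hC']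
  · simp [hX, ringHom_mapHom hC' hX', mapHom_X]

end IsCenter

theorem isCenter_subalgebra_center (k B : Type*) [Field k] [Ring B] [Algebra k B] :
    IsCenter (Subalgebra.center k B).val.toRingHom :=
  ⟨Subtype.val_injective, by ext; simp [Subring.mem_center_iff, Subalgebra.mem_center_iff]⟩

theorem isCenter_subring_center (B : Type*) [Ring B] : IsCenter (Subring.center B).subtype :=
  ⟨Subtype.val_injective, Subring.range_subtype _⟩

theorem X_mem_center_s8 (A : Type u) [Ring A] (n : ℕ) (j : Fin n) :
    X A n j ∈ Subring.center (PolyExt A n) := by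
  rw [← mapHom_X (Subring.center A).subtype]
  exact (isCenter_subring_center A).mapHom_mem_center _

/-- If either `Z` or `Z / N(Z)`, for `Z` the center of `A`, satisfies the one-dimensionality
condition, then every isomorphism of centers of polynomial extensions agrees on the
indeterminates with an automorphism of the target fixing the constants. -/
theorem exists_ringEquiv_of_center {k A B : Type u} [Field k] [Ring A] [Algebra k A] [Ring B]
    (hA : DomainTrdegOneNotPolynomial k (Subalgebra.center k A) ∨
      DomainTrdegOneNotPolynomial k
        (Subalgebra.center k A ⧸ nilradical (Subalgebra.center k A)))
    (ω : Subring.center (PolyExt A n) ≃+* Subring.center (PolyExt B n)) :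
    ∃ θ : PolyExt B n ≃+* PolyExt B n, (∀ b, θ (const B n b) = const B n b) ∧
      ∀ j, θ (X B n j) = ω ⟨X A n j, X_mem_center_s8 A n j⟩ := by
  let hi := isCenter_subalgebra_center k A
  let hj := isCenter_subring_center B
  let φ := ((hi.centerEquiv n).trans ω).trans (hj.centerEquiv n).symm
  have hb : Function.Bijective (MvPolynomial.aeval (R := Subring.center B)
      fun j => φ (MvPolynomial.X j)) :=
    hA.elim (fun h => h.bijective_aeval φ) fun h => h.bijective_aeval_of_quotient φ
  obtain ⟨θ, hC, hX⟩ := hj.exists_ringEquiv (AlgEquiv.ofBijective _ hb)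
  refine ⟨θ, hC, fun j => ?_⟩
  rw [hX, AlgEquiv.coe_ofBijective, MvPolynomial.aeval_X]
  rw [← hj.coe_centerEquiv]
  simp only [φ, RingEquiv.trans_apply, RingEquiv.apply_symm_apply]
  congr 2
  exact Subtype.ext (mapHom_X _ j)

/-- Evaluation of all indeterminates at zero. -/
noncomputable def aug (B : Type u) [Ring B] (n : ℕ) : PolyExt B n →+* B :=
  AddMonoidAlgebra.liftNCRingHom (RingHom.id B)
    ({ toFun := fun γ => if γ.toAdd = 0 then 1 else 0
       map_one' := by simp
       map_mul' := fun x y => by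
        simp only [toAdd_mul, add_eq_zero]
        by_cases hx : x.toAdd = 0 <;> by_cases hy : y.toAdd = 0 <;> simp [hx, hy] } :
      Multiplicative (Fin n →₀ ℕ) →* B)
    fun b γ => by
      change Commute b (if γ.toAdd = 0 then 1 else 0)
      split_ifs
      exacts [Commute.one_right b, Commute.zero_right b]

theorem aug_const (b : B) : aug B n (const B n b) = b := by
  refine (AddMonoidAlgebra.liftNCRingHom_single _ _ _ _ _).trans ?_
  simp

theorem aug_X (j : Fin n) : aug B n (X B n j) = 0 := by
  refine (AddMonoidAlgebra.liftNCRingHom_single _ _ _ _ _).trans ?_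
  simp

theorem aug_comp_const_aug {R : Type*} [Ring R] (f : PolyExt B n →+* R)
    (hf : ∀ j, f (X B n j) = 0) (x : PolyExt B n) : f (const B n (aug B n x)) = f x := by
  have : (f.comp (const B n)).comp (aug B n) = f :=
    ringHom_ext (fun b => by simp [aug_const]) fun j => by simp [aug_X, hf]
  exact RingHom.congr_fun this x

/-- An isomorphism of polynomial extensions preserving the indeterminates induces an isomorphism
of the coefficient rings. -/
noncomputable def ringEquivOfX {A : Type u} [Ring A] (ψ : PolyExt A n ≃+* PolyExt B n)
    (hψ : ∀ j, ψ (X A n j) = X B n j) : A ≃+* B :=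
  RingEquiv.ofRingHom (((aug B n).comp (ψ : _ →+* _)).comp (const A n))
    (((aug A n).comp (ψ.symm : _ →+* _)).comp (const B n))
    (RingHom.ext fun b => by
      have := aug_comp_const_aug ((aug B n).comp (ψ : PolyExt A n →+* PolyExt B n))
        (by simp [hψ, aug_X]) (ψ.symm (const B n b))
      simpa [aug_const] using this)
    (RingHom.ext fun a => by
      have := aug_comp_const_aug ((aug A n).comp (ψ.symm : PolyExt B n →+* PolyExt A n))
        (by simp [← hψ, aug_X]) (ψ (const A n a))
      simpa [aug_const] using this)

theorem ringEquivOfX_apply {A : Type u} [Ring A] (ψ : PolyExt A n ≃+* PolyExt B n)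
    (hψ : ∀ j, ψ (X A n j) = X B n j) (a : A) :
    ringEquivOfX ψ hψ a = aug B n (ψ (const A n a)) := rfl

end PolyExt

theorem stronglyCancellative_of_center {k A : Type u} [Field k] [Ring A] [Algebra k A]
    (hA : DomainTrdegOneNotPolynomial k (Subalgebra.center k A) ∨
      DomainTrdegOneNotPolynomial k
        (Subalgebra.center k A ⧸ nilradical (Subalgebra.center k A))) :
    StronglyCancellative k A := by
  rintro n - B _ _ ⟨φ⟩
  obtain ⟨θ, hC, hX⟩ := PolyExt.exists_ringEquiv_of_center (n := n) (B := B) hA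
    (Subring.centerCongr φ.toRingEquiv)
  have hs : ∀ b, θ.symm (PolyExt.const B n b) = PolyExt.const B n b := fun b => by
    rw [RingEquiv.symm_apply_eq, hC]
  refine ⟨AlgEquiv.ofRingEquiv
    (f := PolyExt.ringEquivOfX (φ.toRingEquiv.trans θ.symm) fun j => ?_) fun c => ?_⟩
  · rw [RingEquiv.trans_apply, RingEquiv.symm_apply_eq, hX]
    rfl
  · rw [PolyExt.ringEquivOfX_apply]
    have h : φ (PolyExt.const A n (algebraMap k A c)) = PolyExt.const B n (algebraMap k B c) :=
      φ.commutes c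
    change PolyExt.aug B n (θ.symm (φ _)) = _
    rw [h, hs, PolyExt.aug_const]

section
open CategoryTheory

namespace CategoryTheory.CatCenter
variable {C D : Type*} [Category C] [Category D] [Preadditive C] [Preadditive D]

/-- Transport of the center along an additive equivalence. -/
noncomputable def mapEquivalence (e : C ≌ D) [e.functor.Additive] : CatCenter C →+* CatCenter D where
  toFun z :=
    { app := fun Y => e.counitInv.app Y ≫ e.functor.map (z.app (e.inverse.obj Y)) ≫ e.counit.app Y
      naturality := fun Y Y' f => by
        have h := congrArg e.functor.map (z.naturality (e.inverse.map f))
        rw [Functor.map_comp, Functor.map_comp] at h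
        have h1 : f ≫ e.counitInv.app Y' =
          e.counitInv.app Y ≫ e.functor.map (e.inverse.map f) := e.counitInv.naturality f
        have h2 : e.functor.map (e.inverse.map f) ≫ e.counit.app Y' = e.counit.app Y ≫ f :=
          e.counit.naturality f
        change f ≫ e.counitInv.app Y' ≫ _ = (e.counitInv.app Y ≫ _) ≫ f
        rw [reassoc_of% h1, reassoc_of% h, h2]
        simp only [Category.assoc] }
  map_one' := by ext Y; simp [CatCenter.app, End.one_def]
  map_zero' := by ext Y; simp [CatCenter.app]
  map_add' x y := by ext Y; simp [CatCenter.app]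
  map_mul' x y := by
    ext Y
    rw [CatCenter.mul_app']
    simp [CatCenter.app, End.mul_def]

theorem mapEquivalence_app_obj (e : C ≌ D) [e.functor.Additive] (z : CatCenter C) (X : C) :
    (mapEquivalence e z).app (e.functor.obj X) = e.functor.map (z.app X) := by
  change e.counitInv.app _ ≫ e.functor.map (z.app _) ≫ e.counit.app _ = _
  have h : e.unit.app X ≫ z.app (e.inverse.obj (e.functor.obj X)) = z.app X ≫ e.unit.app X :=
    z.naturality (e.unit.app X)
  rw [e.counitInv_app_functor, ← Category.assoc, ← e.functor.map_comp, h]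
  simp

theorem mapEquivalence_symm_apply (e : C ≌ D) [e.functor.Additive] [e.symm.functor.Additive]
    (z : CatCenter C) : mapEquivalence e.symm (mapEquivalence e z) = z := by
  ext X
  change e.unit.app _ ≫ e.inverse.map ((mapEquivalence e z).app (e.functor.obj X)) ≫
    e.unitInv.app _ = _
  have h : e.inverse.map (e.functor.map (z.app X)) ≫ e.unitInv.app X =
    e.unitInv.app X ≫ z.app X := e.unitInv.naturality _
  rw [mapEquivalence_app_obj, h]
  simp

theorem exists_ringEquiv (e : C ≌ D) [e.functor.Additive] [e.symm.functor.Additive] :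
    ∃ ε : CatCenter C ≃+* CatCenter D, ∀ z X,
      (ε z).app (e.functor.obj X) = e.functor.map (z.app X) :=
  have : e.symm.symm.functor.Additive := inferInstanceAs e.functor.Additive
  ⟨RingEquiv.ofRingHom (mapEquivalence e) (mapEquivalence e.symm)
    (RingHom.ext fun z => mapEquivalence_symm_apply e.symm z)
    (RingHom.ext fun z => mapEquivalence_symm_apply e z), mapEquivalence_app_obj e⟩

end CategoryTheory.CatCenter

/-- The action of central elements of `S` on `S`-modules. -/
noncomputable def ModuleCat.centerHom (S : Type u) [Ring S] :
    Subring.center S →+* CatCenter (ModuleCat.{u} S) where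
  toFun z :=
    { app := fun M => ModuleCat.ofHom
        { toFun := fun m => (z : S) • (m : M)
          map_add' := fun _ _ => smul_add _ _ _
          map_smul' := fun s m => by
            rw [smul_smul, ← Subring.mem_center_iff.1 z.2 s, mul_smul]; rfl }
      naturality := fun M N f => by
        ext m
        exact (map_smul f.hom (z : S) m).symm }
  map_one' := by ext M m; exact one_smul S m
  map_zero' := by ext M m; exact zero_smul S m
  map_add' x y := by ext M m; exact add_smul (x : S) (y : S) m
  map_mul' x y := by
    ext M m
    exact mul_smul (x : S) (y : S) m

theorem ModuleCat.centerHom_app {S : Type u} [Ring S] (z : Subring.center S)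
    (M : ModuleCat.{u} S) (m : M) : ((centerHom S z).app M).hom m = (z : S) • m := rfl

theorem ModuleCat.centerHom_bijective (S : Type u) [Ring S] :
    Function.Bijective (centerHom S) := by
  constructor
  · intro x y h
    have := congrArg (fun t : CatCenter (ModuleCat.{u} S) =>
      (t.app (ModuleCat.of S S)).hom (1 : S)) h
    exact Subtype.ext (((mul_one _).symm.trans this).trans (mul_one _))
  · intro t
    let c : S := (t.app (ModuleCat.of S S)).hom (1 : S)
    have key : ∀ (M : ModuleCat.{u} S) (m : M), (t.app M).hom m = c • m := by
      intro M m
      have := congrArg (fun g => g.hom (1 : S))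
        (t.naturality (ModuleCat.ofHom (LinearMap.toSpanSingleton S M m) :
          ModuleCat.of S S ⟶ M))
      simpa using this
    have hc : c ∈ Subring.center S := Subring.mem_center_iff.2 fun s => by
      have h1 := key (ModuleCat.of S S) s
      have h2 := map_smul (t.app (ModuleCat.of S S)).hom s (1 : S)
      simp only [smul_eq_mul, mul_one] at h1 h2
      exact h2.symm.trans h1
    refine ⟨⟨c, hc⟩, ?_⟩
    ext M m
    exact (key M m).symm

/-- An equivalence of module categories induces an isomorphism of centers compatible with the
actions on modules. -/
theorem ModuleCat.exists_center_ringEquiv {S T : Type u} [Ring S] [Ring T]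
    (e : ModuleCat.{u} S ≌ ModuleCat.{u} T) :
    ∃ ω : Subring.center S ≃+* Subring.center T, ∀ (z : Subring.center S) (M : ModuleCat.{u} S),
      (∀ m : M, (z : S) • m = 0) ↔ ∀ m : e.functor.obj M, (ω z : T) • m = 0 := by
  have : e.functor.Additive := e.functor.additive_of_preserves_binary_products
  have : e.symm.functor.Additive := e.symm.functor.additive_of_preserves_binary_products
  obtain ⟨ε, hε⟩ := CatCenter.exists_ringEquiv e
  let σ := RingEquiv.ofBijective _ (centerHom_bijective S)
  let τ := RingEquiv.ofBijective _ (centerHom_bijective T)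
  refine ⟨(σ.trans ε).trans τ.symm, fun z M => ?_⟩
  have h : centerHom T (τ.symm (ε (σ z))) = ε (centerHom S z) :=
    τ.apply_symm_apply _
  have h0 : ∀ {R : Type u} [Ring R] (z : Subring.center R) (M : ModuleCat.{u} R),
      (∀ m : M, (z : R) • m = 0) ↔ (centerHom R z).app M = 0 := by
    intro R _ z M
    refine ⟨fun h => ?_, fun h m => ?_⟩
    · ext m
      exact h m
    · rw [← centerHom_app, h]
      rfl
  rw [h0, h0]
  change _ ↔ (centerHom T (τ.symm (ε (σ z)))).app _ = 0
  rw [h, hε, Functor.map_eq_zero_iff]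

/-- Restriction of scalars along a split surjection of rings identifies modules over the quotient
with the modules on which elements identified by the retraction act equally. -/
theorem ModuleCat.nonempty_equivalence_fullSubcategory {S T : Type u} [Ring S] [Ring T]
    (f : S →+* T) (g : T →+* S) (hfg : ∀ t, f (g t) = t) (P : ObjectProperty (ModuleCat.{u} S))
    (hP : ∀ M, P M ↔ ∀ (s : S) (m : M), g (f s) • m = s • m) :
    Nonempty (ModuleCat.{u} T ≌ P.FullSubcategory) := by
  let F : ModuleCat.{u} T ⥤ P.FullSubcategory := P.lift (ModuleCat.restrictScalars f) fun M =>
    (hP _).2 fun s m => by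
      rw [ModuleCat.restrictScalars.smul_def, ModuleCat.restrictScalars.smul_def, hfg]
  have hfull : (ModuleCat.restrictScalars.{u} f).Full := ⟨fun {M N} h =>
    ⟨ModuleCat.ofHom
      { toFun := h.hom
        map_add' := fun x y => map_add h.hom x y
        map_smul' := fun t m => by
          have : (h.hom (f (g t) • (m : M) : M) : N) = f (g t) • (h.hom m : N) :=
            h.hom.map_smul (g t) m
          rwa [hfg] at this }, rfl⟩⟩
  have : F.Full := inferInstanceAs (P.lift _ _).Full
  have : F.Faithful := inferInstanceAs (P.lift _ _).Faithful
  have : F.EssSurj := ⟨fun M => ⟨(ModuleCat.restrictScalars g).obj M.obj, ⟨by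
    have hM := (hP _).1 M.property
    let N : ModuleCat S := (ModuleCat.restrictScalars f).obj ((ModuleCat.restrictScalars g).obj M.obj)
    let l : N ≃ₗ[S] M.obj :=
      { toFun := fun m => m
        invFun := fun m => m
        left_inv := fun _ => rfl
        right_inv := fun _ => rfl
        map_add' := fun _ _ => rfl
        map_smul' := fun s m => hM s m }
    exact P.isoMk (show N ≅ M.obj from l.toModuleIso)⟩⟩⟩
  have : F.IsEquivalence := { }
  exact ⟨F.asEquivalence⟩

theorem PolyExt.forall_smul_eq_iff {B : Type u} [Ring B] {n : ℕ} (θ : PolyExt B n ≃+* PolyExt B n)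
    (hC : ∀ b, θ (const B n b) = const B n b) {M : Type u} [AddCommGroup M]
    [Module (PolyExt B n)ᵐᵒᵖ M] :
    (∀ (s : (PolyExt B n)ᵐᵒᵖ) (m : M),
      MulOpposite.op (const B n (aug B n (θ.symm s.unop))) • m = s • m) ↔
    ∀ j (m : M), MulOpposite.op (θ (X B n j)) • m = 0 := by
  constructor
  · intro h j m
    rw [← h]
    simp [aug_X]
  · intro h s m
    let f : PolyExt B n →+* (AddMonoid.End M)ᵐᵒᵖ :=
      { toFun := fun x => MulOpposite.op
          (Module.toAddMonoidEnd (PolyExt B n)ᵐᵒᵖ M (MulOpposite.op (θ x)))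
        map_one' := by simp
        map_zero' := by simp
        map_add' := by simp
        map_mul' := by simp }
    have := aug_comp_const_aug f (fun j => MulOpposite.unop_injective <|
      AddMonoidHom.ext fun m => h j m) (θ.symm s.unop)
    have := DFunLike.congr_fun (congrArg MulOpposite.unop this) m
    change MulOpposite.op (θ _) • m = MulOpposite.op (θ _) • m at this
    rwa [hC, RingEquiv.apply_symm_apply] at this

theorem stronglyMoritaCancellative_of_center {k A : Type u} [Field k] [Ring A] [Algebra k A]
    (hA : DomainTrdegOneNotPolynomial k (Subalgebra.center k A) ∨
      DomainTrdegOneNotPolynomial k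
        (Subalgebra.center k A ⧸ nilradical (Subalgebra.center k A))) :
    StronglyMoritaCancellative k A := by
  rintro n - B _ _ ⟨e⟩
  obtain ⟨ω, hω⟩ := ModuleCat.exists_center_ringEquiv e
  obtain ⟨θ, hC, hX⟩ := PolyExt.exists_ringEquiv_of_center (n := n) (B := B) hA
    ((Subring.centerToMulOpposite.trans ω).trans Subring.centerToMulOpposite.symm)
  let P : ObjectProperty (ModuleCat.{u} (PolyExt A n)ᵐᵒᵖ) := fun M =>
    ∀ j (m : M), MulOpposite.op (PolyExt.X A n j) • m = 0
  let Q : ObjectProperty (ModuleCat.{u} (PolyExt B n)ᵐᵒᵖ) := fun M =>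
    ∀ j (m : M), MulOpposite.op (θ (PolyExt.X B n j)) • m = 0
  have hPQ : Q.inverseImage e.functor = P := by
    ext M
    refine forall_congr' fun j => ?_
    rw [hX]
    exact (hω (Subring.centerToMulOpposite ⟨_, PolyExt.X_mem_center_s8 A n j⟩) M).symm
  have : Q.IsClosedUnderIsomorphisms := ⟨fun {M N} i hM j m => by
    have := congrArg i.hom.hom (hM j (i.inv.hom m))
    simpa using this⟩
  obtain ⟨eP⟩ := ModuleCat.nonempty_equivalence_fullSubcategory (PolyExt.aug A n).op
    (PolyExt.const A n).op (fun t => congrArg MulOpposite.op (PolyExt.aug_const t.unop)) P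
    fun M => (PolyExt.forall_smul_eq_iff (RingEquiv.refl _) (fun _ => rfl)).symm
  obtain ⟨eQ⟩ := ModuleCat.nonempty_equivalence_fullSubcategory
    ((PolyExt.aug B n).comp (θ.symm : _ →+* _)).op
    (PolyExt.const B n).op (fun t => congrArg MulOpposite.op (by
      have : θ.symm (PolyExt.const B n t.unop) = PolyExt.const B n t.unop := by
        rw [RingEquiv.symm_apply_eq, hC]
      simp [this, PolyExt.aug_const])) Q
    fun M => (PolyExt.forall_smul_eq_iff θ hC).symm
  exact ⟨(eP.trans (e.congrFullSubcategory hPQ)).trans eQ.symm⟩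

end

/-- With `D` equal to either `Z = Z(A)` or `Z/N(Z)`: if `D` is an
integral domain of transcendence degree one over a subfield and is not isomorphic to a
polynomial ring `k'[x]` over an intermediate field, then `D` is strongly retractable,
and consequently `A` is strongly cancellative and strongly Morita cancellative. -/
theorem strongly_cancellative_of_center_trdeg_one_not_polynomial
    (k A : Type u) [Field k] [Ring A] [Algebra k A] :
    (DomainTrdegOneNotPolynomial k (Subalgebra.center k A) →
      StronglyRetractable k (Subalgebra.center k A) ∧
        StronglyCancellative k A ∧ StronglyMoritaCancellative k A) ∧
    (DomainTrdegOneNotPolynomial k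
        ((Subalgebra.center k A) ⧸ nilradical (Subalgebra.center k A)) →
      StronglyRetractable k
          ((Subalgebra.center k A) ⧸ nilradical (Subalgebra.center k A)) ∧
        StronglyCancellative k A ∧ StronglyMoritaCancellative k A) := by
  exact ⟨fun h => ⟨h.stronglyRetractable, stronglyCancellative_of_center (Or.inl h),
      stronglyMoritaCancellative_of_center (Or.inl h)⟩,
    fun h => ⟨h.stronglyRetractable, stronglyCancellative_of_center (Or.inr h),
      stronglyMoritaCancellative_of_center (Or.inr h)⟩⟩
end
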